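/- Let p > 3 be prime and let a, b ∈ F_p^* with 4a³ + 27b² ≠ 0. Let E : y² = x³ + ax + b and a_p(E) := p − #{(x, y) ∈ F_p × F_p : y² = x³ + ax + b}. Then, as an identity in ℚ_p, a_p(E) = (−φ(b)·p/(p−1)) · [ 1 − Σ_{j=1}^{p−2} (−p)^{E_j} · (Γ_p(⟨−j/(p−1)⟩) · Γ_p(⟨3j/(p−1)⟩) · Γ_p(⟨−4j/(p−1)⟩) / Γ_p(⟨−2j/(p−1)⟩)) · ω̄^{j}(16b²/a³) ], where E_j := ⌊−2j/(p−1)⌋ − ⌊−j/(p−1)⌋ − ⌊3j/(p−1)⌋ − ⌊−4j/(p−1)⌋ − 1. -/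

import Mathlib

/-- The rational `q`, regarded as a `p`-adic integer (when `q ∈ ℚ ∩ ℤ_p`). -/
noncomputable def toZp (p : ℕ) [Fact p.Prime] (q : ℚ) : ℤ_[p] :=
  if h : ‖(q : ℚ_[p])‖ ≤ 1 then ⟨(q : ℚ_[p]), h⟩ else 0

open PowerSeries in
/-- The Dwork exponential `exp (ϖ (X - X ^ p))` as a formal power series. -/
noncomputable def dworkSeries {K : Type*} [Field K] [CharZero K] (p : ℕ) [Fact p.Prime] (ϖ : K) :
    PowerSeries K :=
  rescale ϖ (exp K) * expand p (Fact.out : p.Prime).ne_zero (rescale (-ϖ) (exp K))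

section Formal

open PowerSeries

variable {K : Type*} [Field K] [CharZero K] {p : ℕ} [Fact p.Prime] (ϖ : K)

lemma coeff_rescale_exp (n : ℕ) : coeff n (rescale ϖ (exp K)) = ϖ ^ n / (n.factorial : K) := by
  simp [coeff_rescale, coeff_exp, div_eq_mul_inv]

lemma dworkSeries_mul_expand :
    dworkSeries p ϖ * expand p (Fact.out : p.Prime).ne_zero (rescale ϖ (exp K)) =
      rescale ϖ (exp K) := by
  have h : rescale (-ϖ) (exp K) * rescale ϖ (exp K) = 1 := by
    rw [exp_mul_exp_eq_exp_add]
    simp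
  rw [dworkSeries, mul_assoc, ← map_mul, h, map_one, mul_one]

lemma rescale_exp_pow (n : ℕ) : rescale ϖ (exp K) ^ n = rescale (n * ϖ) (exp K) := by
  rw [← map_pow, exp_pow_eq_rescale_exp, rescale_rescale, mul_comm]

lemma dworkSeries_pow :
    dworkSeries p ϖ ^ p = rescale (p * ϖ) (exp K) *
      expand p (Fact.out : p.Prime).ne_zero (rescale (-(p * ϖ)) (exp K)) := by
  rw [dworkSeries, mul_pow, ← map_pow (expand p _), rescale_exp_pow, rescale_exp_pow, mul_neg]

lemma X_mul_derivative_rescale_exp :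
    X * derivative K (rescale ϖ (exp K)) = C ϖ * X * rescale ϖ (exp K) := by
  ext n
  rcases n with _ | n
  · simp [mul_assoc, mul_left_comm]
  · rw [coeff_succ_X_mul, mul_assoc, coeff_C_mul, coeff_succ_X_mul, coeff_derivative,
      coeff_rescale_exp, coeff_rescale_exp, Nat.factorial_succ]
    have : ((n.factorial : ℕ) : K) ≠ 0 := mod_cast n.factorial_ne_zero
    have : (n : K) + 1 ≠ 0 := mod_cast n.succ_ne_zero
    push_cast
    field_simp
    ring

lemma coeff_X_mul_derivative (f : PowerSeries K) (n : ℕ) :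
    coeff n (X * derivative K f) = n * coeff n f := by
  rcases n with _ | n
  · simp
  · rw [coeff_succ_X_mul, coeff_derivative]
    push_cast
    ring

lemma X_mul_derivative_expand (f : PowerSeries K) {q : ℕ} (hq : q ≠ 0) :
    X * derivative K (expand q hq f) = C (q : K) * expand q hq (X * derivative K f) := by
  ext n
  rw [coeff_X_mul_derivative, coeff_C_mul]
  by_cases h : q ∣ n
  · obtain ⟨m, rfl⟩ := h
    rw [coeff_expand_mul, coeff_expand_mul, coeff_X_mul_derivative]
    push_cast
    ring
  · rw [coeff_expand_of_not_dvd _ _ _ h, coeff_expand_of_not_dvd _ _ _ h]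
    ring

lemma X_mul_derivative_dworkSeries :
    X * derivative K (dworkSeries p ϖ) =
      C ϖ * (X * dworkSeries p ϖ - C (p : K) * (X ^ p * dworkSeries p ϖ)) := by
  have h1 := X_mul_derivative_rescale_exp ϖ
  have h2 := X_mul_derivative_expand (rescale (-ϖ) (exp K))
    (Fact.out : p.Prime).ne_zero
  rw [X_mul_derivative_rescale_exp, map_mul, map_mul, expand_C, expand_X, map_neg] at h2
  rw [dworkSeries, Derivation.leibniz, smul_eq_mul, smul_eq_mul]
  linear_combination (expand p (Fact.out : p.Prime).ne_zero (rescale (-ϖ) (exp K))) * h1 +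
    (rescale ϖ (exp K)) * h2

/-- The coefficients of the Dwork exponential, extended by zero to negative indices. -/
noncomputable def dworkCoeff (p : ℕ) [Fact p.Prime] (ϖ : K) (n : ℤ) : K :=
  if 0 ≤ n then coeff n.toNat (dworkSeries p ϖ) else 0

lemma dworkCoeff_natCast (n : ℕ) : dworkCoeff p ϖ n = coeff n (dworkSeries p ϖ) := by
  simp [dworkCoeff]

lemma dworkCoeff_recurrence (n : ℤ) :
    n * dworkCoeff p ϖ n = ϖ * (dworkCoeff p ϖ (n - 1) - p * dworkCoeff p ϖ (n - p)) := by
  have hp := (Fact.out : p.Prime).pos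
  rcases lt_or_ge n 0 with h | h
  · rw [dworkCoeff, dworkCoeff, dworkCoeff, if_neg (by lia), if_neg (by lia), if_neg (by lia)]
    ring
  · lift n to ℕ using h
    have := congrArg (coeff n) (X_mul_derivative_dworkSeries (p := p) ϖ)
    rw [coeff_X_mul_derivative, coeff_C_mul, map_sub, coeff_C_mul, coeff_X_pow_mul'] at this
    rw [dworkCoeff_natCast, Int.cast_natCast, this]
    congr 3
    · rcases n with _ | n
      · simp [dworkCoeff]
      · rw [coeff_succ_X_mul]
        push_cast
        rw [add_sub_cancel_right, dworkCoeff_natCast]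
    · split_ifs with h
      · rw [← Nat.cast_sub h, dworkCoeff_natCast]
      · rw [dworkCoeff, if_neg (by lia)]

lemma sum_coeff_dworkSeries {a : ℕ} (ha : a < p) (N : ℕ) :
    ∑ m ∈ Finset.range (N + 1),
      coeff (p * m + a) (dworkSeries p ϖ) * (ϖ ^ (N - m) / ((N - m).factorial : K)) =
      ϖ ^ (p * N + a) / ((p * N + a).factorial : K) := by
  have hp := (Fact.out : p.Prime)
  have := congrArg (coeff (p * N + a)) (dworkSeries_mul_expand (p := p) ϖ)
  rw [coeff_rescale_exp] at this
  rw [← this, coeff_mul]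
  symm
  rw [← Finset.Nat.sum_antidiagonal_eq_sum_range_succ
    (f := fun m k => coeff (p * m + a) (dworkSeries p ϖ) * (ϖ ^ k / (k.factorial : K)))]
  symm
  refine Finset.sum_of_injOn (fun x => (p * x.1 + a, p * x.2)) ?_ ?_ ?_ ?_
  · rintro ⟨x, y⟩ _ ⟨x', y'⟩ _ h
    simpa [hp.ne_zero] using h
  · rintro ⟨x, y⟩ h
    simp only [Finset.mem_coe, Finset.HasAntidiagonal.mem_antidiagonal] at h ⊢
    rw [← h]
    ring
  · rintro ⟨x, y⟩ h h'
    rw [Finset.HasAntidiagonal.mem_antidiagonal] at h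
    dsimp only at h ⊢
    rw [coeff_expand_of_not_dvd, mul_zero]
    rintro ⟨k, rfl⟩
    refine h' ⟨(N - k, k), ?_, ?_⟩
    · have : p * k < p * (N + 1) := by rw [mul_add]; lia
      have := Nat.lt_of_mul_lt_mul_left this
      rw [Finset.mem_coe, Finset.HasAntidiagonal.mem_antidiagonal]
      lia
    · have : p * k < p * (N + 1) := by rw [mul_add]; lia
      have := Nat.lt_of_mul_lt_mul_left this
      have h3 : k ≤ N := by lia
      simp only [Prod.mk.injEq, and_true]
      rw [Nat.mul_sub]
      have := Nat.mul_le_mul_left p h3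
      lia
  · rintro ⟨x, y⟩ h
    rw [coeff_expand_mul, coeff_rescale_exp]

end Formal

section Telescope

variable {K : Type*} [Field K]

/-- The coefficients occurring when a monomial is reduced to a constant modulo the image of the
twisted differential operator `g ↦ X g' + s g + ϖ X g`. -/
noncomputable def reductionCoeff (ϖ s : K) (N j : ℕ) : K :=
  ϖ⁻¹ * ∏ i ∈ Finset.Ico (j + 1) N, (-(s + i) / ϖ)

/-- Diagonal-type coefficients of the Frobenius operator composed with the reduction of
monomials. -/
noncomputable def frobeniusReduction (Θ : ℤ → K) (p a : ℕ) (ϖ s : K) (N : ℕ) (m : ℤ) : K :=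
  ∑ j ∈ Finset.range N, Θ (p * m + a - j) * reductionCoeff ϖ s N j

variable {Θ : ℤ → K} {p a : ℕ} {ϖ s : K}

lemma frobeniusReduction_succ (hϖ : ϖ ≠ 0) (N : ℕ) (m : ℤ) :
    ϖ * frobeniusReduction Θ p a ϖ s (N + 1) m =
      Θ (p * m + a - N) - (s + N) * frobeniusReduction Θ p a ϖ s N m := by
  rw [frobeniusReduction, Finset.sum_range_succ, frobeniusReduction, mul_add, 
    add_comm, Finset.mul_sum, Finset.mul_sum, sub_eq_add_neg (Θ _), ← Finset.sum_neg_distrib]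
  congr 1
  · simp [reductionCoeff]
    field_simp
  · refine Finset.sum_congr rfl fun j hj => ?_
    rw [reductionCoeff, reductionCoeff, Finset.prod_Ico_succ_top (by simpa using hj)]
    field_simp

lemma frobenius_eq_reduction (hϖ : ϖ ≠ 0)
    (hΘ : ∀ n : ℤ, n * Θ n = ϖ * (Θ (n - 1) - p * Θ (n - p)))
    (hs : p * s = s + a) (k : ℕ) (m : ℤ) :
    Θ (p * m + a - k) = (∏ i ∈ Finset.range k, (-(s + i) / ϖ)) * Θ (p * m + a) +
      p * ((m + s) * frobeniusReduction Θ p a ϖ s k m +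
        ϖ * frobeniusReduction Θ p a ϖ s k (m - 1)) := by
  induction k with
  | zero => simp [frobeniusReduction]
  | succ k ih =>
    have h1 := frobeniusReduction_succ (Θ := Θ) (p := p) (a := a) (s := s) hϖ k m
    have h2 := frobeniusReduction_succ (Θ := Θ) (p := p) (a := a) (s := s) hϖ k (m - 1)
    have h3 := hΘ (p * m + a - k)
    have e1 : (p * m + a - k - 1 : ℤ) = p * m + a - (k + 1) := by ring
    have e2 : (p * (m - 1) + a - k : ℤ) = p * m + a - k - p := by ring
    rw [e1] at h3
    rw [e2] at h2
    push_cast at h3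
    rw [Finset.prod_range_succ, Nat.cast_add_one]
    apply mul_left_cancel₀ hϖ
    set P := ∏ i ∈ Finset.range k, (-(s + i) / ϖ)
    have e3 : ϖ * (P * (-(s + k) / ϖ) * Θ (p * m + a)) = -(s + k) * P * Θ (p * m + a) := by
      field_simp
    rw [mul_add, e3]
    linear_combination -h3 - (s + k) * ih - p * (m + s) * h1 - p * ϖ * h2 - Θ (p * m + a - k) * hs

lemma sum_frobenius_diagonal (hϖ : ϖ ≠ 0)
    (hΘ : ∀ n : ℤ, n * Θ n = ϖ * (Θ (n - 1) - p * Θ (n - p)))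
    (hs : p * s = s + a) (N : ℕ) :
    (1 - p) * ∑ k ∈ Finset.range N, Θ ((p - 1) * k + a) =
      ∑ k ∈ Finset.range N, (∏ i ∈ Finset.range k, (-(s + i) / ϖ)) * Θ (p * k + a) -
        p * ϖ * frobeniusReduction Θ p a ϖ s N (N - 1) := by
  induction N with
  | zero => simp [frobeniusReduction]
  | succ N ih =>
    rw [Finset.sum_range_succ, Finset.sum_range_succ, mul_add, ih]
    have h1 := frobenius_eq_reduction hϖ hΘ hs N N
    have h2 := frobeniusReduction_succ (Θ := Θ) (p := p) (a := a) (s := s) hϖ N N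
    have e1 : ((p - 1) * N + a : ℤ) = p * N + a - N := by ring
    have e2 : ((N + 1 : ℕ) - 1 : ℤ) = N := by push_cast; ring
    rw [e1, e2]
    push_cast at h1 h2 ⊢
    linear_combination h1 + p * h2

end Telescope

section MoritaGamma

/-- The defining properties of Morita's `p`-adic gamma function. -/
structure IsMoritaGamma (p : ℕ) [Fact p.Prime] (Γ : ℤ_[p] → ℤ_[p]) : Prop where
  continuous : Continuous Γ
  map_zero : Γ 0 = 1
  map_natCast : ∀ m : ℕ, 0 < m → Γ (m : ℤ_[p]) =
    (-1) ^ m * ∏ k ∈ (Finset.Ico 1 m).filter (fun k => ¬ p ∣ k), (k : ℤ_[p])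

variable {p : ℕ} [Fact p.Prime] {Γ : ℤ_[p] → ℤ_[p]}

lemma padicInt_coe_prod {ι : Type*} (s : Finset ι) (f : ι → ℤ_[p]) :
    ((∏ i ∈ s, f i : ℤ_[p]) : ℚ_[p]) = ∏ i ∈ s, (f i : ℚ_[p]) :=
  map_prod PadicInt.Coe.ringHom f s

lemma prod_filter_not_dvd_mul {a : ℕ} (ha : a < p) (N : ℕ) :
    (∏ k ∈ (Finset.Ico 1 (p * N + a + 1)).filter (fun k => ¬ p ∣ k), k) *
      (p ^ N * N.factorial) = (p * N + a).factorial := by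
  have hp := (Fact.out : p.Prime)
  have h : (Finset.Ico 1 (p * N + a + 1)).filter (fun k => p ∣ k) =
      (Finset.Ico 1 (N + 1)).image (p * ·) := by
    ext k
    simp only [Finset.mem_filter, Finset.mem_Ico, Finset.mem_image]
    constructor
    · rintro ⟨h, k, rfl⟩
      refine ⟨k, ⟨Nat.pos_of_mul_pos_left (by lia : 0 < p * k), ?_⟩, rfl⟩
      have : p * k < p * (N + 1) := by rw [mul_add]; lia
      exact Nat.lt_of_mul_lt_mul_left this
    · rintro ⟨k, ⟨h1, h2⟩, rfl⟩
      have := Nat.mul_le_mul_left p (Nat.lt_succ_iff.mp h2)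
      have := Nat.mul_pos hp.pos h1
      exact ⟨by lia, dvd_mul_right _ _⟩
  rw [← Finset.prod_Ico_id_eq_factorial (p * N + a),
    ← Finset.prod_filter_mul_prod_filter_not (Finset.Ico 1 (p * N + a + 1)) (fun k => p ∣ k)
      (fun x => x)]
  rw [h, Finset.prod_image (fun x _ y _ h => Nat.eq_of_mul_eq_mul_left hp.pos h),
    Finset.prod_mul_distrib, Finset.prod_const, Finset.prod_Ico_id_eq_factorial,
    Nat.card_Ico, Nat.add_sub_cancel, mul_comm]

lemma IsMoritaGamma.norm_natCast (hΓ : IsMoritaGamma p Γ) (m : ℕ) : ‖Γ m‖ = 1 := by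
  rcases Nat.eq_zero_or_pos m with rfl | h
  · simp [hΓ.map_zero]
  · rw [hΓ.map_natCast m h, norm_mul, norm_pow, norm_neg, norm_one, one_pow, one_mul,
      norm_prod]
    refine Finset.prod_eq_one fun k hk => ?_
    rw [PadicInt.norm_natCast_eq_one_iff]
    exact (Fact.out : p.Prime).coprime_iff_not_dvd.mpr (Finset.mem_filter.mp hk).2

lemma IsMoritaGamma.norm_eq_one (hΓ : IsMoritaGamma p Γ) (x : ℤ_[p]) : ‖Γ x‖ = 1 :=
  congrFun (PadicInt.denseRange_natCast.equalizer (hΓ.continuous.norm) continuous_const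
    (funext fun n => hΓ.norm_natCast n) : (fun x => ‖Γ x‖) = fun _ => 1) x

lemma IsMoritaGamma.ne_zero (hΓ : IsMoritaGamma p Γ) (x : ℤ_[p]) : (Γ x : ℚ_[p]) ≠ 0 := by
  have := hΓ.norm_eq_one x
  rw [PadicInt.norm_def] at this
  exact norm_ne_zero_iff.mp (by rw [this]; exact one_ne_zero)

lemma IsMoritaGamma.map_mul_add (hΓ : IsMoritaGamma p Γ) {a : ℕ} (ha : a < p) (N : ℕ) :
    (Γ (1 + a + p * N) : ℚ_[p]) =
      (-1) ^ (p * N + a + 1) * ((p * N + a).factorial / (p ^ N * N.factorial)) := by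
  have hp := (Fact.out : p.Prime)
  have h0 : ((p : ℚ_[p]) ^ N * N.factorial) ≠ 0 := by
    have := hp.ne_zero
    have := N.factorial_ne_zero
    positivity
  have h1 := hΓ.map_natCast (p * N + a + 1) (Nat.succ_pos _)
  have h2 : ((p * N + a + 1 : ℕ) : ℤ_[p]) = 1 + a + p * N := by push_cast; ring
  rw [h2] at h1
  rw [h1, ← prod_filter_not_dvd_mul ha N]
  push_cast
  rw [mul_div_cancel_right₀ _ h0, padicInt_coe_prod]
  simp

/-- A normalised reciprocal of Morita's gamma function along a residue class. -/
noncomputable def IsMoritaGamma.recip (hΓ : IsMoritaGamma p Γ) (a : ℕ) : C(ℤ_[p], ℚ_[p]) where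
  toFun x := (-1) ^ (a + 1) / (Γ (1 + a + p * x) : ℚ_[p])
  continuous_toFun := by
    refine continuous_const.div ?_ fun x => hΓ.ne_zero _
    exact continuous_subtype_val.comp (hΓ.continuous.comp (by fun_prop))

lemma IsMoritaGamma.recip_natCast (hΓ : IsMoritaGamma p Γ) (hp2 : p ≠ 2) {a : ℕ} (ha : a < p)
    (N : ℕ) :
    hΓ.recip a N = (-p : ℚ_[p]) ^ N * N.factorial / (p * N + a).factorial := by
  have hp := (Fact.out : p.Prime)
  change (-1) ^ (a + 1) / (Γ (1 + a + p * N) : ℚ_[p]) = _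
  rw [hΓ.map_mul_add ha, neg_pow (p : ℚ_[p])]
  have h1 : (p : ℚ_[p]) ≠ 0 := mod_cast hp.ne_zero
  have h2 : (N.factorial : ℚ_[p]) ≠ 0 := mod_cast N.factorial_ne_zero
  have h3 : ((p * N + a).factorial : ℚ_[p]) ≠ 0 := mod_cast (p * N + a).factorial_ne_zero
  have h4 : (-1 : ℚ_[p]) ^ (p * N + a + 1) = (-1) ^ N * (-1) ^ (a + 1) := by
    rw [add_assoc, pow_add, pow_mul, (hp.odd_of_ne_two hp2).neg_one_pow]
  have h5 : ((-1 : ℚ_[p]) ^ N) * (-1) ^ N = 1 := by rw [← mul_pow]; simp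
  have h6 : ((-1 : ℚ_[p]) ^ N) ≠ 0 := by simp
  rw [h4]
  field_simp
  linear_combination -h5

end MoritaGamma

section Mahler

open Filter Topology PowerSeries fwdDiff

lemma eq_of_sum_choose_mul_eq {K : Type*} [Ring K] {u v : ℕ → K}
    (h : ∀ N, ∑ m ∈ Finset.range (N + 1), (N.choose m : K) * u m =
      ∑ m ∈ Finset.range (N + 1), (N.choose m : K) * v m) (n : ℕ) : u n = v n := by
  induction n using Nat.strong_induction_on with
  | _ n ih =>
    have := h n
    rw [Finset.sum_range_succ, Finset.sum_range_succ, Finset.sum_congr rfl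
      (fun m hm => by rw [ih m (Finset.mem_range.mp hm)])] at this
    simpa using this

lemma uniformizer_ne_zero {p : ℕ} [Fact p.Prime] {K : Type*} [Field K] [CharZero K] {ϖ : K}
    (hϖ : ϖ ^ (p - 1) = -p) : ϖ ≠ 0 := by
  rintro rfl
  have hp := (Fact.out : p.Prime)
  rw [zero_pow (by have := hp.two_le; lia)] at hϖ
  have : (p : K) ≠ 0 := mod_cast hp.ne_zero
  exact this (by linear_combination hϖ)

variable {p : ℕ} [Fact p.Prime] {Γ : ℤ_[p] → ℤ_[p]} {K : Type*} [NormedField K] [CharZero K]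
  [NormedAlgebra ℚ_[p] K] {ϖ : K}

lemma fwdDiff_recip_eq (hΓ : IsMoritaGamma p Γ) (hp2 : p ≠ 2) (hϖ : ϖ ^ (p - 1) = -p) {a : ℕ}
    (ha : a < p) (m : ℕ) :
    ϖ ^ a * algebraMap ℚ_[p] K ((fwdDiff 1)^[m] (hΓ.recip a) 0) =
      m.factorial / ϖ ^ m * coeff (p * m + a) (dworkSeries p ϖ) := by
  have h0 := uniformizer_ne_zero hϖ
  have hp := (Fact.out : p.Prime)
  refine eq_of_sum_choose_mul_eq (u := fun m =>
    ϖ ^ a * algebraMap ℚ_[p] K ((fwdDiff 1)^[m] (hΓ.recip a) 0))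
    (v := fun m => m.factorial / ϖ ^ m * coeff (p * m + a) (dworkSeries p ϖ)) (fun N => ?_) m
  have h1 := congrArg (algebraMap ℚ_[p] K) (shift_eq_sum_fwdDiff_iter 1 (hΓ.recip a) N 0)
  simp only [nsmul_eq_mul, mul_one, zero_add, map_sum, map_mul, map_natCast] at h1
  simp_rw [mul_left_comm _ (ϖ ^ a)]
  rw [← Finset.mul_sum, ← h1, hΓ.recip_natCast hp2 ha]
  have h2 := sum_coeff_dworkSeries ϖ ha N
  have h3 : (N.factorial : K) ≠ 0 := mod_cast N.factorial_ne_zero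
  have h4 : ϖ ^ (p * N + a) = ϖ ^ N * (ϖ ^ a * (-p) ^ N) := by
    rw [← hϖ, ← pow_mul, ← pow_add, ← pow_add]
    congr 1
    obtain ⟨q, rfl⟩ : ∃ q, p = q + 1 := ⟨p - 1, by have := hp.pos; lia⟩
    simp only [add_tsub_cancel_right]
    ring
  have h5 : ∀ m ∈ Finset.range (N + 1), (N.choose m : K) *
      (m.factorial / ϖ ^ m * coeff (p * m + a) (dworkSeries p ϖ)) = N.factorial / ϖ ^ N *
      (coeff (p * m + a) (dworkSeries p ϖ) * (ϖ ^ (N - m) / ((N - m).factorial : K))) := by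
    intro m hm
    have hm := Nat.lt_succ_iff.mp (Finset.mem_range.mp hm)
    rw [Nat.cast_choose K hm]
    have e1 : ϖ ^ N = ϖ ^ m * ϖ ^ (N - m) := by rw [← pow_add]; congr 1; lia
    have e2 : (m.factorial : K) ≠ 0 := mod_cast m.factorial_ne_zero
    have e3 : ((N - m).factorial : K) ≠ 0 := mod_cast (N - m).factorial_ne_zero
    rw [e1]
    field_simp
  rw [Finset.sum_congr rfl h5, ← Finset.mul_sum, h2, h4]
  simp only [map_div₀, map_mul, map_pow, map_neg, map_natCast]
  field_simp

lemma smeval_descPochhammer {R : Type*} [CommRing R] (k : ℕ) (x : R) :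
    (descPochhammer ℤ k).smeval x = ∏ i ∈ Finset.range k, (x - i) := by
  induction k with
  | zero => simp [Polynomial.smeval_one]
  | succ k ih =>
    rw [descPochhammer_succ_right, Polynomial.smeval_mul, ih, Finset.prod_range_succ,
      Polynomial.smeval_sub, Polynomial.smeval_X, Polynomial.smeval_natCast]
    simp

lemma prod_neg_add_div {σ : ℤ_[p]} (k : ℕ) :
    ∏ i ∈ Finset.range k, (-(algebraMap ℚ_[p] K σ + i) / ϖ) =
      algebraMap ℚ_[p] K (mahler k (-σ) : ℤ_[p]) * k.factorial / ϖ ^ k := by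
  rw [Finset.prod_div_distrib, Finset.prod_const, Finset.card_range]
  congr 1
  have h1 := Ring.descPochhammer_eq_factorial_smul_choose (-σ) k
  rw [smeval_descPochhammer] at h1
  have h2 := congrArg (fun x : ℤ_[p] => algebraMap ℚ_[p] K x) h1
  rw [mahler_apply, mul_comm]
  simp only [nsmul_eq_mul, PadicInt.coe_mul, map_mul, PadicInt.coe_natCast, map_natCast] at h2
  rw [← h2, padicInt_coe_prod, map_prod]
  refine Finset.prod_congr rfl fun i _ => ?_
  rw [PadicInt.coe_sub, PadicInt.coe_neg, PadicInt.coe_natCast, map_sub, map_neg, map_natCast]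
  ring

lemma hasSum_reduction (hΓ : IsMoritaGamma p Γ) (hp2 : p ≠ 2) (hϖ : ϖ ^ (p - 1) = -p) {a : ℕ}
    (ha : a < p) (σ : ℤ_[p]) :
    HasSum (fun k : ℕ => (∏ i ∈ Finset.range k, (-(algebraMap ℚ_[p] K σ + i) / ϖ)) *
      dworkCoeff p ϖ (p * k + a)) (ϖ ^ a * algebraMap ℚ_[p] K (hΓ.recip a (-σ))) := by
  have : IsBoundedSMul ℤ_[p] ℚ_[p] := IsBoundedSMul.of_norm_smul_le fun x y =>
    norm_mul_le (x : ℚ_[p]) y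
  have h1 := PadicInt.hasSum_mahler (hΓ.recip a)
  have h2 := ((ContinuousMap.hasSum_apply h1 (-σ)).map (algebraMap ℚ_[p] K)
    (algebraMapCLM ℚ_[p] K).continuous).mul_left (ϖ ^ a)
  refine h2.congr_fun fun k => ?_
  have h3 := fwdDiff_recip_eq hΓ hp2 hϖ ha k
  have h0 := uniformizer_ne_zero hϖ
  rw [Function.comp_apply, PadicInt.mahlerTerm_apply, prod_neg_add_div]
  have e : (p * k + a : ℤ) = (p * k + a : ℕ) := by push_cast; rfl
  rw [e, dworkCoeff_natCast]
  have e2 : ∀ (x : ℤ_[p]) (y : ℚ_[p]), x • y = (x : ℚ_[p]) * y := fun x y => rfl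
  rw [e2, map_mul]
  linear_combination -algebraMap ℚ_[p] K (mahler k (-σ) : ℤ_[p]) * h3

end Mahler

section CoefficientBounds

open Filter Topology PowerSeries

variable {p : ℕ} [Fact p.Prime] {Γ : ℤ_[p] → ℤ_[p]}

lemma IsMoritaGamma.norm_recip (hΓ : IsMoritaGamma p Γ) (a : ℕ) (x : ℤ_[p]) :
    ‖hΓ.recip a x‖ = 1 := by
  change ‖(-1) ^ (a + 1) / (Γ (1 + a + p * x) : ℚ_[p])‖ = 1
  rw [norm_div, norm_pow, norm_neg, norm_one, one_pow, ← PadicInt.norm_def, hΓ.norm_eq_one,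
    div_one]

lemma IsMoritaGamma.norm_fwdDiff_recip_le (hΓ : IsMoritaGamma p Γ) (a m : ℕ) :
    ‖(fwdDiff 1)^[m] (hΓ.recip a) 0‖ ≤ 1 :=
  (IsUltrametricDist.norm_fwdDiff_iter_apply_le 1 (hΓ.recip a) 0 m).trans
    ((ContinuousMap.norm_le _ zero_le_one).mpr fun x => (hΓ.norm_recip a x).le)

lemma dvd_one_add_prod_range (k : ℕ) : p ∣ 1 + ∏ i ∈ Finset.range (p - 1), (p * k + 1 + i) := by
  rw [← ZMod.natCast_eq_zero_iff]
  have h := ZMod.wilsons_lemma p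
  rw [← Finset.prod_range_add_one_eq_factorial] at h
  push_cast at h ⊢
  simp only [CharP.cast_eq_zero, zero_mul, zero_add]
  simp_rw [add_comm (1 : ZMod p) (_ : ZMod p)]
  rw [h]
  simp

lemma IsMoritaGamma.norm_recip_succ_sub_lt (hΓ : IsMoritaGamma p Γ) (hp2 : p ≠ 2) (k : ℕ) :
    ‖hΓ.recip 0 (k + 1 : ℕ) - hΓ.recip 0 k‖ < 1 := by
  have hp := (Fact.out : p.Prime)
  have h1 := hΓ.recip_natCast hp2 hp.pos k
  have h2 := hΓ.recip_natCast hp2 hp.pos (k + 1)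
  have h3 : (p * (k + 1)).factorial = (p * k).factorial *
      ((∏ i ∈ Finset.range (p - 1), (p * k + 1 + i)) * (p * (k + 1))) := by
    rw [mul_add_one, ← Nat.factorial_mul_ascFactorial, Nat.ascFactorial_eq_prod_range]
    obtain ⟨q, hq⟩ : ∃ q, p = q + 1 := ⟨p - 1, by have := hp.pos; lia⟩
    rw [hq, Finset.prod_range_succ, Nat.add_sub_cancel]
    congr 2
    ring
  have h4 : hΓ.recip 0 (k + 1 : ℕ) - hΓ.recip 0 k = hΓ.recip 0 (k + 1 : ℕ) *
      ((1 + ∏ i ∈ Finset.range (p - 1), (p * k + 1 + i) : ℕ) : ℚ_[p]) := by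
    have e1 : (p : ℚ_[p]) ≠ 0 := mod_cast hp.ne_zero
    have e2 : ((p * k).factorial : ℚ_[p]) ≠ 0 := mod_cast (p * k).factorial_ne_zero
    have e3 : ((∏ i ∈ Finset.range (p - 1), (p * k + 1 + i) : ℕ) : ℚ_[p]) ≠ 0 := by
      exact_mod_cast Finset.prod_ne_zero_iff.mpr fun i _ => by lia
    have e4 : (k + 1 : ℚ_[p]) ≠ 0 := mod_cast k.succ_ne_zero
    rw [h1, h2, add_zero, add_zero, h3, Nat.factorial_succ, Nat.cast_add 1, Nat.cast_one]
    generalize (∏ i ∈ Finset.range (p - 1), (p * k + 1 + i)) = P at e3 ⊢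
    push_cast
    field_simp
    ring
  rw [h4, norm_mul, hΓ.norm_recip, one_mul, Padic.norm_natCast_lt_one_iff]
  exact dvd_one_add_prod_range k

lemma IsMoritaGamma.norm_fwdDiff_recip_lt (hΓ : IsMoritaGamma p Γ) (hp2 : p ≠ 2) (m : ℕ) :
    ‖(fwdDiff 1)^[m + 1] (hΓ.recip 0) 0‖ < 1 := by
  rw [Function.iterate_succ_apply, fwdDiff_iter_eq_sum_shift]
  obtain ⟨k, -, hk⟩ := IsUltrametricDist.exists_norm_finsetSum_le (Finset.range (m + 1))
    (fun k : ℕ => ((-1 : ℤ) ^ (m - k) * (m.choose k : ℤ)) •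
      fwdDiff 1 (hΓ.recip 0) (0 + k • (1 : ℤ_[p])))
  refine hk.trans_lt ?_
  rw [zsmul_eq_mul, norm_mul]
  refine mul_lt_one_of_nonneg_of_lt_one_right (Padic.norm_int_le_one _) (norm_nonneg _) ?_
  have := hΓ.norm_recip_succ_sub_lt hp2 k
  simpa [fwdDiff] using this

lemma norm_natCast_eq_padic {K : Type*} [NormedField K] [NormedAlgebra ℚ_[p] K] (n : ℕ) :
    ‖(n : K)‖ = ‖(n : ℚ_[p])‖ := by
  rw [← map_natCast (algebraMap ℚ_[p] K), norm_algebraMap']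

variable {K : Type*} [NormedField K] [NormedAlgebra ℚ_[p] K] {ϖ : K}

lemma norm_uniformizer_pow (hϖ : ϖ ^ (p - 1) = -p) : ‖ϖ‖ ^ (p - 1) = (p : ℝ)⁻¹ := by
  rw [← norm_pow, hϖ, norm_neg, norm_natCast_eq_padic (p := p), Padic.norm_p]

lemma norm_uniformizer_lt_one (hϖ : ϖ ^ (p - 1) = -p) : ‖ϖ‖ < 1 := by
  by_contra! h
  have h1 := one_le_pow₀ h (n := p - 1)
  rw [norm_uniformizer_pow hϖ] at h1
  have : (1 : ℝ) < p := mod_cast (Fact.out : p.Prime).one_lt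
  exact absurd h1 (not_le.mpr (inv_lt_one_of_one_lt₀ this))

variable [CharZero K]

lemma norm_pow_div_factorial (hϖ : ϖ ^ (p - 1) = -p) (m : ℕ) :
    ‖ϖ ^ m / (m.factorial : K)‖ = ‖ϖ‖ ^ (p.digits m).sum := by
  have h0 : ‖ϖ‖ ≠ 0 := norm_ne_zero_iff.mpr (uniformizer_ne_zero hϖ)
  have h1 : ‖(m.factorial : K)‖ = ‖ϖ‖ ^ (m - (p.digits m).sum) := by
    rw [← sub_one_mul_padicValNat_factorial, pow_mul, norm_uniformizer_pow hϖ,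
      norm_natCast_eq_padic (p := p),
      Padic.norm_eq_zpow_neg_valuation (mod_cast m.factorial_ne_zero), Padic.valuation_natCast,
      zpow_neg, zpow_natCast, inv_pow]
  rw [norm_div, norm_pow, h1, div_eq_iff (pow_ne_zero _ h0), ← pow_add]
  congr 1
  have := Nat.digit_sum_le p m
  lia

lemma coeff_dworkSeries_eq (hΓ : IsMoritaGamma p Γ) (hp2 : p ≠ 2) (hϖ : ϖ ^ (p - 1) = -p) {a : ℕ}
    (ha : a < p) (m : ℕ) :
    coeff (p * m + a) (dworkSeries p ϖ) =
      ϖ ^ a * algebraMap ℚ_[p] K ((fwdDiff 1)^[m] (hΓ.recip a) 0) *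
        (ϖ ^ m / (m.factorial : K)) := by
  have h0 := uniformizer_ne_zero hϖ
  have h1 : (m.factorial : K) ≠ 0 := mod_cast m.factorial_ne_zero
  rw [fwdDiff_recip_eq hΓ hp2 hϖ ha]
  field_simp

lemma norm_coeff_dworkSeries (hΓ : IsMoritaGamma p Γ) (hp2 : p ≠ 2) (hϖ : ϖ ^ (p - 1) = -p)
    {a : ℕ} (ha : a < p) (m : ℕ) :
    ‖coeff (p * m + a) (dworkSeries p ϖ)‖ =
      ‖ϖ‖ ^ a * ‖(fwdDiff 1)^[m] (hΓ.recip a) 0‖ * ‖ϖ‖ ^ (p.digits m).sum := by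
  rw [coeff_dworkSeries_eq hΓ hp2 hϖ ha, norm_mul, norm_mul, norm_pow, norm_algebraMap',
    norm_pow_div_factorial hϖ]

lemma tendsto_coeff_dworkSeries (hΓ : IsMoritaGamma p Γ) (hp2 : p ≠ 2) (hϖ : ϖ ^ (p - 1) = -p) :
    Tendsto (fun n => coeff n (dworkSeries p ϖ)) atTop (𝓝 0) := by
  have hp := (Fact.out : p.Prime)
  have : IsBoundedSMul ℤ_[p] ℚ_[p] := IsBoundedSMul.of_norm_smul_le fun x y =>
    norm_mul_le (x : ℚ_[p]) y
  have h := (norm_uniformizer_lt_one hϖ).le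
  have h1 : ∀ a, Tendsto (fun m => ‖(fwdDiff 1)^[m] (hΓ.recip a) 0‖) atTop (𝓝 0) := fun a => by
    simpa using (PadicInt.fwdDiff_tendsto_zero (hΓ.recip a)).norm
  have h2 : Tendsto (fun m => ∑ a ∈ Finset.range p, ‖(fwdDiff 1)^[m] (hΓ.recip a) 0‖) atTop
      (𝓝 0) := by
    simpa using tendsto_finsetSum (Finset.range p) fun a _ => h1 a
  refine squeeze_zero_norm (fun n => ?_) (h2.comp (Nat.tendsto_div_const_atTop hp.ne_zero))
  have h3 := Nat.mod_lt n hp.pos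
  conv_lhs => rw [← Nat.div_add_mod n p, norm_coeff_dworkSeries hΓ hp2 hϖ h3]
  refine le_trans ?_ (Finset.single_le_sum (f := fun a => ‖(fwdDiff 1)^[n / p] (hΓ.recip a) 0‖)
    (fun a _ => norm_nonneg _) (Finset.mem_range.mpr h3))
  refine (mul_le_of_le_one_right (by positivity) (pow_le_one₀ (norm_nonneg _) h)).trans ?_
  exact mul_le_of_le_one_left (norm_nonneg _) (pow_le_one₀ (norm_nonneg _) h)

lemma norm_coeff_dworkSeries_lt (hΓ : IsMoritaGamma p Γ) (hp2 : p ≠ 2) (hϖ : ϖ ^ (p - 1) = -p)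
    {n : ℕ} (hn : 2 ≤ n) : ‖coeff n (dworkSeries p ϖ)‖ < ‖ϖ‖ := by
  have hp := (Fact.out : p.Prime)
  have h := norm_uniformizer_lt_one hϖ
  have h0 : 0 < ‖ϖ‖ := norm_pos_iff.mpr (uniformizer_ne_zero hϖ)
  have h3 := Nat.mod_lt n hp.pos
  have h5 := hΓ.norm_fwdDiff_recip_le (n % p) (n / p)
  have h6 : ∀ k, 2 ≤ k → ‖ϖ‖ ^ k < ‖ϖ‖ := fun k hk => by
    simpa using pow_lt_pow_right_of_lt_one₀ h0 h hk
  have h4 := Nat.div_add_mod n p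
  rw [← h4, norm_coeff_dworkSeries hΓ hp2 hϖ h3]
  rcases Nat.eq_zero_or_pos (n / p) with hm | hm
  · rw [hm] at h4 h5 ⊢
    rw [Nat.digits_zero, List.sum_nil, pow_zero, mul_one]
    exact (mul_le_of_le_one_right (by positivity) h5).trans_lt (h6 _ (by lia))
  · have h7 : 1 ≤ (p.digits (n / p)).sum := by
      by_contra! h8
      have h11 := List.sum_eq_zero_iff.mp (Nat.lt_one_iff.mp h8)
      have h12 := Nat.getLast_digit_ne_zero p hm.ne'
      exact h12 (h11 _ (List.getLast_mem _))
    rcases Nat.eq_zero_or_pos (n % p) with ha | ha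
    · rw [ha, pow_zero, one_mul]
      obtain ⟨m, hm⟩ := Nat.exists_eq_add_of_le' hm
      have h8 := hΓ.norm_fwdDiff_recip_lt hp2 m
      rw [← hm] at h8
      calc _ ≤ ‖(fwdDiff 1)^[n / p] (hΓ.recip 0) 0‖ * ‖ϖ‖ := by
            gcongr
            simpa using pow_le_pow_of_le_one h0.le h.le h7
        _ < _ := mul_lt_of_lt_one_left h0 h8
    · calc _ ≤ ‖ϖ‖ ^ (n % p) * 1 * ‖ϖ‖ ^ (p.digits (n / p)).sum := by gcongr
        _ = ‖ϖ‖ ^ (n % p + (p.digits (n / p)).sum) := by rw [mul_one, pow_add]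
        _ < _ := h6 _ (by lia)

end CoefficientBounds

/-- The integers `a (p ^ r - 1) / (p - 1)`, which converge to `-a / (p - 1)`. -/
def repdigit (p a r : ℕ) : ℕ := a * ∑ i ∈ Finset.range r, p ^ i

lemma sub_one_mul_repdigit {p : ℕ} (hp : 1 ≤ p) (a r : ℕ) :
    (p - 1) * repdigit p a r + a = a * p ^ r := by
  have h := geom_sum_mul_add (p - 1) r
  rw [Nat.sub_add_cancel hp] at h
  rw [repdigit, ← h]
  ring

lemma repdigit_lt {p a : ℕ} (ha0 : 0 < a) (ha : a < p) (r : ℕ) : repdigit p a r < p ^ r := by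
  have h := sub_one_mul_repdigit (p := p) (by lia) a r
  have h2 : a * p ^ r ≤ (p - 1) * p ^ r := Nat.mul_le_mul_right _ (by lia)
  exact Nat.lt_of_mul_lt_mul_left (a := p - 1) (by lia)

section FrobeniusTrace

open Filter Topology PowerSeries

variable {p : ℕ} [Fact p.Prime] {Γ : ℤ_[p] → ℤ_[p]} {K : Type*} [NormedField K]
  [NormedAlgebra ℚ_[p] K] {ϖ : K}

lemma sum_digits_le {m r : ℕ} (hm : m < p ^ r) : (p.digits m).sum ≤ (p - 1) * r := by
  have hp := (Fact.out : p.Prime)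
  have h1 : (p.digits m).length ≤ r := (Nat.digits_length_le_iff hp.one_lt m).mpr hm
  have h2 := List.sum_le_card_nsmul (p.digits m) (p - 1) fun d hd =>
    Nat.le_sub_one_of_lt (Nat.digits_lt_base hp.one_lt hd)
  rw [smul_eq_mul, mul_comm] at h2
  exact h2.trans (Nat.mul_le_mul_left _ h1)

lemma inv_norm_pow_le_norm_natCast {l r : ℕ} (hl0 : l ≠ 0) (hl : l < p ^ r) :
    ((p : ℝ) ^ r)⁻¹ ≤ ‖(l : ℚ_[p])‖ := by
  by_contra! h
  have h1 := (Padic.norm_int_le_pow_iff_dvd (p := p) (l : ℤ) r).mp (by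
    rw [zpow_neg, zpow_natCast]; exact_mod_cast h.le)
  exact absurd (Nat.le_of_dvd (Nat.pos_of_ne_zero hl0) (by exact_mod_cast h1)) (not_le.mpr hl)

variable [IsUltrametricDist K]

lemma norm_prod_mul_sub_natCast_le {x : K} {r : ℕ} (hx : ‖x‖ ≤ ((p : ℝ) ^ r)⁻¹) {L : ℕ}
    (hL : L < p ^ r) :
    ‖∏ l ∈ Finset.range (L + 1), (x - l)‖ ≤ ((p : ℝ) ^ r)⁻¹ * ‖(L.factorial : K)‖ := by
  rw [Finset.prod_range_succ', norm_mul, mul_comm, ← Finset.prod_range_add_one_eq_factorial]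
  push_cast
  rw [norm_prod, norm_prod, sub_zero]
  refine mul_le_mul hx (Finset.prod_le_prod (fun _ _ => norm_nonneg _) fun l hl => ?_)
    (Finset.prod_nonneg fun _ _ => norm_nonneg _) (by positivity)
  have h1 : ((p : ℝ) ^ r)⁻¹ ≤ ‖((l + 1 : ℕ) : K)‖ := by
    rw [norm_natCast_eq_padic (p := p)]
    exact inv_norm_pow_le_norm_natCast l.succ_ne_zero (by have := Finset.mem_range.mp hl; lia)
  push_cast at h1
  have h2 := IsUltrametricDist.norm_add_le_max x (-(l + 1))
  rw [norm_neg, ← sub_eq_add_neg] at h2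
  exact h2.trans (max_le (hx.trans h1) le_rfl)

variable [CharZero K]

lemma norm_reductionCoeff_le (hϖ : ϖ ^ (p - 1) = -p) {s : K} {M r : ℕ}
    (hs : ‖s + M‖ ≤ ((p : ℝ) ^ r)⁻¹) (hM : M < p ^ r) {j : ℕ} (hj : j ≤ M) :
    ‖reductionCoeff ϖ s (M + 1) j‖ ≤ (‖ϖ‖ ^ 2)⁻¹ := by
  have h0 : 0 < ‖ϖ‖ := norm_pos_iff.mpr (uniformizer_ne_zero hϖ)
  have h1 := norm_uniformizer_lt_one hϖ
  have hp := (Fact.out : p.Prime)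
  rw [reductionCoeff, norm_mul, norm_inv]
  obtain ⟨L, rfl⟩ := Nat.exists_eq_add_of_le hj
  rcases L with _ | L
  · simp only [add_zero, Finset.Ico_self, Finset.prod_empty, norm_one, mul_one]
    gcongr
    simpa using pow_le_pow_of_le_one h0.le h1.le one_le_two
  · have h2 : ∏ i ∈ Finset.Ico (j + 1) (j + (L + 1) + 1), (-(s + i) / ϖ) =
        (∏ l ∈ Finset.range (L + 1), ((s + (j + (L + 1) : ℕ)) - l)) * (-1) ^ (L + 1) /
          ϖ ^ (L + 1) := by
      rw [Finset.prod_div_distrib, Finset.prod_const, Nat.card_Ico]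
      congr 2
      · rw [Finset.prod_neg, Nat.card_Ico, mul_comm, Finset.prod_Ico_eq_prod_range,
          show j + (L + 1) + 1 - (j + 1) = L + 1 by lia, ← Finset.prod_range_reflect]
        congr 1
        refine Finset.prod_congr rfl fun l hl => ?_
        have := Finset.mem_range.mp hl
        rw [show L + 1 - 1 - l = L - l by lia]
        push_cast [Nat.cast_sub (by lia : l ≤ L)]
        ring
      · lia
    have h3 := norm_prod_mul_sub_natCast_le hs (L := L) (by lia)
    have h4 := norm_pow_div_factorial hϖ L
    have h5 : ((p : ℝ) ^ r)⁻¹ ≤ ‖ϖ‖ ^ (p.digits L).sum := by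
      rw [← inv_pow, ← norm_uniformizer_pow hϖ, ← pow_mul]
      exact pow_le_pow_of_le_one h0.le h1.le (sum_digits_le (by lia))
    have h6 : ‖(L.factorial : K)‖ ≠ 0 := norm_ne_zero_iff.mpr (mod_cast L.factorial_ne_zero)
    rw [norm_div, norm_pow, div_eq_iff h6] at h4
    rw [h2, norm_div, norm_mul, norm_pow, norm_pow, norm_neg, norm_one, one_pow, mul_one]
    calc _ ≤ ‖ϖ‖⁻¹ * ((‖ϖ‖ ^ (p.digits L).sum * ‖(L.factorial : K)‖) / ‖ϖ‖ ^ (L + 1)) := by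
          gcongr
          exact h3.trans (by gcongr)
      _ = _ := by
          rw [← h4]
          field_simp
          ring

lemma le_repdigit {a : ℕ} (ha0 : 0 < a) (r : ℕ) : r ≤ repdigit p a r := by
  have h : ∑ i ∈ Finset.range r, 1 ≤ ∑ i ∈ Finset.range r, p ^ i :=
    Finset.sum_le_sum fun i _ => Nat.one_le_pow _ _ (Fact.out : p.Prime).pos
  rw [Finset.sum_const, Finset.card_range, smul_eq_mul, mul_one] at h
  exact h.trans (Nat.le_mul_of_pos_left _ ha0)

lemma tendsto_frobeniusReduction (hΓ : IsMoritaGamma p Γ) (hp2 : p ≠ 2) (hϖ : ϖ ^ (p - 1) = -p)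
    {a : ℕ} (ha0 : 0 < a) (ha : a < p) {σ : ℤ_[p]} (hσ : p * σ = σ + a) :
    Tendsto (fun r => frobeniusReduction (dworkCoeff p ϖ) p a ϖ (algebraMap ℚ_[p] K σ)
      (repdigit p a r + 1) (repdigit p a r)) atTop (𝓝 0) := by
  have hp := (Fact.out : p.Prime)
  have h0 : 0 < ‖ϖ‖ := norm_pos_iff.mpr (uniformizer_ne_zero hϖ)
  rw [Metric.tendsto_atTop]
  intro ε hε
  obtain ⟨R, hR⟩ := Metric.tendsto_atTop.mp (tendsto_coeff_dworkSeries hΓ hp2 hϖ)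
    (ε / 2 * ‖ϖ‖ ^ 2) (by positivity)
  refine ⟨R, fun r hr => ?_⟩
  rw [dist_zero_right]
  refine lt_of_le_of_lt ?_ (half_lt_self hε)
  refine IsUltrametricDist.norm_sum_le_of_forall_le_of_nonneg (by positivity) fun j hj => ?_
  have hj := Nat.lt_succ_iff.mp (Finset.mem_range.mp hj)
  have h1 : (p * repdigit p a r + a - j : ℤ) = (p * repdigit p a r + a - j : ℕ) := by
    have : repdigit p a r ≤ p * repdigit p a r := Nat.le_mul_of_pos_left _ hp.pos
    push_cast [Nat.cast_sub (by lia : j ≤ p * repdigit p a r + a)]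
    rfl
  have h2 : R ≤ p * repdigit p a r + a - j := by
    have h3 := le_repdigit (p := p) ha0 r
    have : 2 * repdigit p a r ≤ p * repdigit p a r := Nat.mul_le_mul_right _ hp.two_le
    lia
  have h4 := hR _ h2
  rw [dist_zero_right] at h4
  have h5 : ‖algebraMap ℚ_[p] K σ + repdigit p a r‖ ≤ ((p : ℝ) ^ r)⁻¹ := by
    have e1 : (σ + repdigit p a r : ℤ_[p]) = p ^ r * σ := by
      have e2 := congrArg (Nat.cast (R := ℤ_[p])) (sub_one_mul_repdigit hp.one_le a r)
      push_cast [Nat.cast_sub hp.one_le] at e2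
      have e3 : (p - 1 : ℤ_[p]) ≠ 0 := by
        rw [sub_ne_zero]
        exact_mod_cast hp.one_lt.ne'
      apply mul_left_cancel₀ e3
      linear_combination e2 + (1 - (p : ℤ_[p]) ^ r) * hσ
    have e4 := congrArg (fun x : ℤ_[p] => algebraMap ℚ_[p] K x) e1
    simp only [PadicInt.coe_add, PadicInt.coe_mul, PadicInt.coe_pow, PadicInt.coe_natCast,
      map_add, map_mul, map_pow, map_natCast] at e4
    rw [e4, norm_mul, norm_pow, norm_natCast_eq_padic (p := p), Padic.norm_p, norm_algebraMap',
      inv_pow]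
    exact mul_le_of_le_one_right (by positivity) σ.2
  rw [h1, dworkCoeff_natCast, norm_mul]
  calc _ ≤ ε / 2 * ‖ϖ‖ ^ 2 * (‖ϖ‖ ^ 2)⁻¹ := by
        gcongr
        exact norm_reductionCoeff_le hϖ h5 (repdigit_lt ha0 ha r) hj
    _ = _ := by field_simp

lemma hasSum_coeff_dworkSeries [CompleteSpace K] (hΓ : IsMoritaGamma p Γ) (hp2 : p ≠ 2)
    (hϖ : ϖ ^ (p - 1) = -p) {a : ℕ} (ha0 : 0 < a) (ha : a < p) {σ : ℤ_[p]}
    (hσ : p * σ = σ + a) :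
    HasSum (fun k : ℕ => coeff ((p - 1) * k + a) (dworkSeries p ϖ))
      (ϖ ^ a * ((-1) ^ (a + 1) / algebraMap ℚ_[p] K (Γ (1 - σ))) / (1 - p)) := by
  have hp := (Fact.out : p.Prime)
  have hinj : Function.Injective fun k : ℕ => (p - 1) * k + a := fun x y h => by
    have : p - 1 ≠ 0 := by have := hp.two_le; lia
    simpa [this] using h
  have h1 : Summable fun k : ℕ => coeff ((p - 1) * k + a) (dworkSeries p ϖ) := by
    refine NonarchimedeanAddGroup.summable_of_tendsto_cofinite_zero ?_
    have := tendsto_coeff_dworkSeries hΓ hp2 hϖ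
    rw [← Nat.cofinite_eq_atTop] at this
    exact this.comp hinj.tendsto_cofinite
  have hr : Tendsto (fun r => repdigit p a r + 1) atTop atTop :=
    tendsto_atTop_mono (fun r => (le_repdigit ha0 r).trans (Nat.le_succ _)) tendsto_id
  have h2 := h1.hasSum.tendsto_sum_nat.comp hr
  have h3 := (hasSum_reduction (K := K) hΓ hp2 hϖ ha σ).tendsto_sum_nat.comp hr
  have h4 := tendsto_frobeniusReduction hΓ hp2 hϖ ha0 ha hσ
  have hs := congrArg (fun x : ℤ_[p] => algebraMap ℚ_[p] K x) hσ
  simp only [PadicInt.coe_add, PadicInt.coe_mul, PadicInt.coe_natCast, map_add, map_mul,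
    map_natCast] at hs
  have h5 : ∀ r, (1 - p) * ∑ k ∈ Finset.range (repdigit p a r + 1),
      coeff ((p - 1) * k + a) (dworkSeries p ϖ) =
      ∑ k ∈ Finset.range (repdigit p a r + 1),
        (∏ i ∈ Finset.range k, (-(algebraMap ℚ_[p] K σ + i) / ϖ)) *
          dworkCoeff p ϖ (p * k + a) -
        p * ϖ * frobeniusReduction (dworkCoeff p ϖ) p a ϖ (algebraMap ℚ_[p] K σ)
          (repdigit p a r + 1) (repdigit p a r) := fun r => by
    have := sum_frobenius_diagonal (uniformizer_ne_zero hϖ) (dworkCoeff_recurrence (p := p) ϖ)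
      hs (repdigit p a r + 1)
    rw [show ((repdigit p a r + 1 : ℕ) - 1 : ℤ) = repdigit p a r by push_cast; ring] at this
    rw [← this]
    congr 1
    refine Finset.sum_congr rfl fun k _ => ?_
    rw [← dworkCoeff_natCast]
    congr 1
    push_cast [Nat.cast_sub hp.one_le]
    rfl
  have h6 := tendsto_nhds_unique ((h2.const_mul (1 - p : K)).congr h5)
    (h3.sub (h4.const_mul (p * ϖ)))
  have h7 : (1 - p : K) ≠ 0 := by
    rw [sub_ne_zero]
    exact_mod_cast hp.one_lt.ne
  have h8 : hΓ.recip a (-σ) = (-1) ^ (a + 1) / (Γ (1 - σ) : ℚ_[p]) := by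
    change (-1) ^ (a + 1) / (Γ (1 + a + p * -σ) : ℚ_[p]) = _
    congr 3
    linear_combination -hσ
  rw [mul_zero, sub_zero, h8] at h6
  rw [map_div₀, map_pow, map_neg, map_one] at h6
  convert h1.hasSum using 1
  rw [← h6]
  field_simp

end FrobeniusTrace

section Evaluation

open Filter Topology PowerSeries

variable {K : Type*} [NormedField K]

lemma hasSum_coeff_one (t : K) : HasSum (fun n => coeff n (1 : PowerSeries K) * t ^ n) 1 := by
  convert hasSum_single 0 fun n hn => ?_
  · simp
  · simp [coeff_one, hn]

lemma hasSum_coeff_expand {f : PowerSeries K} {t A : K} {q : ℕ} (hq : q ≠ 0) (ht : t ^ q = t)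
    (hf : HasSum (fun n => coeff n f * t ^ n) A) :
    HasSum (fun n => coeff n (expand q hq f) * t ^ n) A := by
  have hinj : Function.Injective fun n => q * n := mul_right_injective₀ hq
  rw [← hinj.hasSum_iff]
  · convert hf using 2 with n
    rw [Function.comp_apply, coeff_expand_mul, pow_mul, ht]
  · intro n hn
    rw [coeff_expand_of_not_dvd, zero_mul]
    rintro ⟨k, rfl⟩
    exact hn ⟨k, rfl⟩

variable [IsUltrametricDist K]

lemma nonarchimedeanRing_of_isUltrametricDist : NonarchimedeanRing K where
  is_nonarchimedean := NonarchimedeanAddGroup.is_nonarchimedean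

lemma norm_lt_of_hasSum {f : ℕ → K} {A : K} {C : ℝ} (h : HasSum f A)
    (hf : ∀ n, ‖f n‖ < C) : ‖A‖ < C := by
  have h1 : A ∈ Metric.ball (0 : K) C := by
    refine (IsUltrametricDist.isClosed_ball (0 : K) C).mem_of_tendsto h
      (Eventually.of_forall fun s => ?_)
    rw [mem_ball_zero_iff]
    obtain ⟨k, -, hk⟩ := IsUltrametricDist.exists_norm_finsetSum_le s f
    exact hk.trans_lt (hf k)
  simpa using h1

lemma hasSum_coeff_mul {f g : PowerSeries K} {t A B : K}
    (hf : HasSum (fun n => coeff n f * t ^ n) A)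
    (hg : HasSum (fun n => coeff n g * t ^ n) B) :
    HasSum (fun n => coeff n (f * g) * t ^ n) (A * B) := by
  have := nonarchimedeanRing_of_isUltrametricDist (K := K)
  have h := hf.mul_of_nonarchimedean hg
  rw [← (Finset.HasAntidiagonal.sigmaAntidiagonalEquivProd (A := ℕ)).hasSum_iff] at h
  refine h.sigma fun n => ?_
  have h2 : coeff n (f * g) * t ^ n =
      ∑ x : (Finset.HasAntidiagonal.antidiagonal n : Finset (ℕ × ℕ)),
      coeff x.1.1 f * t ^ x.1.1 * (coeff x.1.2 g * t ^ x.1.2) := by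
    rw [coeff_mul, Finset.sum_mul, ← Finset.sum_coe_sort]
    refine Finset.sum_congr rfl fun x _ => ?_
    have hx : t ^ n = t ^ x.1.1 * t ^ x.1.2 := by
      rw [← pow_add, Finset.HasAntidiagonal.mem_antidiagonal.mp x.2]
    rw [hx]
    ring
  rw [h2]
  exact hasSum_fintype _

lemma hasSum_coeff_pow {f : PowerSeries K} {t A : K} (hf : HasSum (fun n => coeff n f * t ^ n) A)
    (k : ℕ) : HasSum (fun n => coeff n (f ^ k) * t ^ n) (A ^ k) := by
  induction k with
  | zero => simpa using hasSum_coeff_one t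
  | succ k ih => simpa only [pow_succ] using hasSum_coeff_mul ih hf

lemma summable_coeff_mul_pow [CompleteSpace K] {f : PowerSeries K}
    (hf : Tendsto (fun n => coeff n f) atTop (𝓝 0))
    {t : K} (ht : ‖t‖ ≤ 1) : Summable fun n => coeff n f * t ^ n := by
  refine NonarchimedeanAddGroup.summable_of_tendsto_cofinite_zero ?_
  rw [Nat.cofinite_eq_atTop]
  refine squeeze_zero_norm (fun n => ?_) (by simpa using hf.norm)
  rw [norm_mul, norm_pow]
  exact mul_le_of_le_one_right (norm_nonneg _) (pow_le_one₀ (norm_nonneg _) ht)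

end Evaluation

section DworkCharacter

open Filter Topology PowerSeries

lemma norm_le_one_of_pow_eq {K : Type*} [NormedField K] {q : ℕ} (hq : 1 < q) {t : K}
    (ht : t ^ q = t) : ‖t‖ ≤ 1 := by
  by_contra! h
  have h1 := pow_lt_pow_right₀ h hq
  rw [pow_one, ← norm_pow, ht] at h1
  exact lt_irrefl _ h1

lemma MulChar.pow_prime_apply {p : ℕ} [Fact p.Prime] {K : Type*} [Field K]
    (χ : MulChar (ZMod p) K) (x : ZMod p) : χ x ^ p = χ x := by
  rw [← map_pow, ZMod.pow_card]

lemma MulChar.norm_apply_le_one {p : ℕ} [Fact p.Prime] {K : Type*} [NormedField K]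
    (χ : MulChar (ZMod p) K) (x : ZMod p) : ‖χ x‖ ≤ 1 :=
  norm_le_one_of_pow_eq (Fact.out : p.Prime).one_lt (χ.pow_prime_apply x)

variable {p : ℕ} [Fact p.Prime] {Γ : ℤ_[p] → ℤ_[p]} {K : Type*} [NormedField K]
  [NormedAlgebra ℚ_[p] K] {ϖ : K}

lemma eq_one_of_pow_eq_one_of_norm_sub_lt [IsUltrametricDist K] (hϖ : ϖ ^ (p - 1) = -p)
    {u : K} (hu : u ^ p = 1)
    (h : ‖u - 1‖ < ‖ϖ‖) : u = 1 := by
  have hp := (Fact.out : p.Prime)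
  have h1 := norm_uniformizer_lt_one hϖ
  have h2 := add_pow_prime_eq hp (u - 1) 1
  rw [sub_add_cancel, hu, one_pow, Finset.sum_eq_sum_sdiff_singleton_add (i := 1)
    (Finset.mem_Ioo.mpr ⟨one_pos, hp.one_lt⟩)] at h2
  set δ := u - 1 with hδ
  have h3 : ‖∑ k ∈ Finset.Ioo 0 p \ {1}, δ ^ (k - 1) * 1 ^ (p - k - 1) *
      ((p.choose k / p : ℕ) : K)‖ < 1 := by
    obtain ⟨k, hk, hk2⟩ := IsUltrametricDist.exists_norm_finsetSum_le (Finset.Ioo 0 p \ {1})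
      fun k => δ ^ (k - 1) * 1 ^ (p - k - 1) * ((p.choose k / p : ℕ) : K)
    rcases (Finset.Ioo 0 p \ {1}).eq_empty_or_nonempty with h4 | h4
    · simp [h4]
    have h5 := hk h4
    simp only [Finset.mem_sdiff, Finset.mem_Ioo, Finset.mem_singleton] at h5
    refine hk2.trans_lt ?_
    rw [one_pow, mul_one, norm_mul, norm_pow, norm_natCast_eq_padic (p := p)]
    exact mul_lt_one_of_nonneg_of_lt_one_left (by positivity)
      (pow_lt_one₀ (norm_nonneg _) (h.trans h1) (by lia))
      (by exact_mod_cast Padic.norm_int_le_one _)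
  set S := ∑ k ∈ Finset.Ioo 0 p \ {1}, δ ^ (k - 1) * 1 ^ (p - k - 1) *
      ((p.choose k / p : ℕ) : K)
  have h4 : ‖S + 1‖ = 1 := by
    rw [IsUltrametricDist.norm_add_eq_max_of_norm_ne_norm (by rw [norm_one]; exact h3.ne),
      norm_one, max_eq_right h3.le]
  rw [Nat.sub_self, pow_zero, one_pow, Nat.choose_one_right, Nat.div_self hp.pos, Nat.cast_one,
    mul_one, mul_one, mul_one] at h2
  by_contra hu1
  have hδ0 : δ ≠ 0 := sub_ne_zero.mpr hu1
  have h5 : δ ^ (p - 1) = -(p * (S + 1)) := by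
    apply mul_left_cancel₀ hδ0
    rw [← pow_succ', Nat.sub_add_cancel hp.one_le]
    linear_combination -h2
  have h6 := congrArg norm h5
  rw [norm_neg, norm_mul, h4, mul_one, norm_pow, norm_natCast_eq_padic (p := p), Padic.norm_p,
    ← norm_uniformizer_pow hϖ] at h6
  have h7 := pow_lt_pow_left₀ h (norm_nonneg _) (n := p - 1) (by have := hp.two_le; lia)
  exact h7.ne h6

variable [CharZero K]

lemma tendsto_coeff_rescale_exp (hϖ : ϖ ^ (p - 1) = -p) {x : K} (hx : ‖x‖ ≤ ‖(p : K) * ϖ‖) :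
    Tendsto (fun n => coeff n (rescale x (exp K))) atTop (𝓝 0) := by
  have h1 := norm_uniformizer_lt_one hϖ
  have h2 : ‖(p : K)‖ < 1 := by
    rw [norm_natCast_eq_padic (p := p), Padic.norm_p]
    exact inv_lt_one_of_one_lt₀ (mod_cast (Fact.out : p.Prime).one_lt)
  refine squeeze_zero_norm (fun n => ?_)
    (tendsto_pow_atTop_nhds_zero_of_lt_one (norm_nonneg _) h2)
  have h3 := norm_pow_div_factorial hϖ n
  rw [norm_div, norm_pow] at h3
  rw [coeff_rescale_exp, norm_div, norm_pow]
  calc _ ≤ ‖(p : K) * ϖ‖ ^ n / ‖(n.factorial : K)‖ := by gcongr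
    _ = ‖(p : K)‖ ^ n * (‖ϖ‖ ^ n / ‖(n.factorial : K)‖) := by rw [norm_mul, mul_pow, mul_div_assoc]
    _ ≤ _ := by
      rw [h3]
      exact mul_le_of_le_one_right (by positivity) (pow_le_one₀ (norm_nonneg _) h1.le)

variable [IsUltrametricDist K]

/-- The value at `t` of the Dwork exponential. -/
noncomputable def dworkEval (p : ℕ) [Fact p.Prime] {K : Type*} [NormedField K] [CharZero K]
    (ϖ t : K) : K := ∑' n, coeff n (dworkSeries p ϖ) * t ^ n

variable [CompleteSpace K]

lemma hasSum_dworkEval (hΓ : IsMoritaGamma p Γ) (hp2 : p ≠ 2) (hϖ : ϖ ^ (p - 1) = -p) {t : K}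
    (ht : ‖t‖ ≤ 1) : HasSum (fun n => coeff n (dworkSeries p ϖ) * t ^ n) (dworkEval p ϖ t) :=
  (summable_coeff_mul_pow (tendsto_coeff_dworkSeries hΓ hp2 hϖ) ht).hasSum

lemma dworkEval_pow (hΓ : IsMoritaGamma p Γ) (hp2 : p ≠ 2) (hϖ : ϖ ^ (p - 1) = -p) {t : K}
    (ht : t ^ p = t) : dworkEval p ϖ t ^ p = 1 := by
  have hp := (Fact.out : p.Prime)
  have ht1 := norm_le_one_of_pow_eq hp.one_lt ht
  have h1 := (summable_coeff_mul_pow (tendsto_coeff_rescale_exp hϖ le_rfl) ht1).hasSum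
  have h2 := (summable_coeff_mul_pow (tendsto_coeff_rescale_exp hϖ (norm_neg _).le) ht1).hasSum
  have h3 := hasSum_coeff_mul h1 h2
  rw [exp_mul_exp_eq_exp_add, add_neg_cancel, rescale_zero_apply] at h3
  have h4 := hasSum_coeff_pow (hasSum_dworkEval hΓ hp2 hϖ ht1) p
  rw [dworkSeries_pow] at h4
  have h5 := hasSum_coeff_mul h1 (hasSum_coeff_expand hp.ne_zero ht h2)
  rw [h4.unique h5]
  exact HasSum.unique (by simpa using h3) (hasSum_coeff_one t)

lemma norm_dworkEval_sub_lt (hΓ : IsMoritaGamma p Γ) (hp2 : p ≠ 2) (hϖ : ϖ ^ (p - 1) = -p) {t : K}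
    (ht : ‖t‖ ≤ 1) : ‖dworkEval p ϖ t - (1 + ϖ * t)‖ < ‖ϖ‖ := by
  have hp := (Fact.out : p.Prime)
  have h0 : 0 < ‖ϖ‖ := norm_pos_iff.mpr (uniformizer_ne_zero hϖ)
  have h1 := (hasSum_nat_add_iff' 2).mpr (hasSum_dworkEval hΓ hp2 hϖ ht)
  have h2 : ∀ n, n < p → coeff n (dworkSeries p ϖ) = ϖ ^ n / (n.factorial : K) := fun n hn => by
    simpa using sum_coeff_dworkSeries ϖ hn 0
  rw [Finset.sum_range_succ, Finset.sum_range_one, h2 0 hp.pos, h2 1 hp.one_lt] at h1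
  have h3 := norm_lt_of_hasSum h1 fun n => by
    rw [norm_mul, norm_pow]
    exact (mul_le_of_le_one_right (norm_nonneg _) (pow_le_one₀ (norm_nonneg _) ht)).trans_lt
      (norm_coeff_dworkSeries_lt hΓ hp2 hϖ (by lia))
  simpa using h3

lemma dworkEval_add (hΓ : IsMoritaGamma p Γ) (hp2 : p ≠ 2) (hϖ : ϖ ^ (p - 1) = -p)
    {χ : MulChar (ZMod p) K} (hχ : ∀ x y, ‖χ (x + y) - χ x - χ y‖ < 1) (x y : ZMod p) :
    dworkEval p ϖ (χ (x + y)) = dworkEval p ϖ (χ x) * dworkEval p ϖ (χ y) := by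
  have hp := (Fact.out : p.Prime)
  have h0 : 0 < ‖ϖ‖ := norm_pos_iff.mpr (uniformizer_ne_zero hϖ)
  have h1 := norm_uniformizer_lt_one hϖ
  have hE : ∀ z, ‖dworkEval p ϖ (χ z) - (1 + ϖ * χ z)‖ < ‖ϖ‖ := fun z =>
    norm_dworkEval_sub_lt hΓ hp2 hϖ (χ.norm_apply_le_one z)
  have hψ : ∀ z, dworkEval p ϖ (χ z) ^ p = 1 := fun z =>
    dworkEval_pow hΓ hp2 hϖ (χ.pow_prime_apply z)
  have hn : ∀ z, ‖dworkEval p ϖ (χ z)‖ = 1 := fun z => by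
    have := congrArg norm (hψ z)
    rw [norm_pow, norm_one] at this
    exact (pow_eq_one_iff_of_nonneg (norm_nonneg _) hp.ne_zero).mp this
  have hD : ∀ z, ‖dworkEval p ϖ (χ z) - 1‖ ≤ ‖ϖ‖ := fun z => by
    have e : dworkEval p ϖ (χ z) - 1 = (dworkEval p ϖ (χ z) - (1 + ϖ * χ z)) + ϖ * χ z := by ring
    rw [e]
    refine (IsUltrametricDist.norm_add_le_max _ _).trans (max_le (hE z).le ?_)
    rw [norm_mul]
    exact mul_le_of_le_one_right h0.le (χ.norm_apply_le_one z)
  have hne : ∀ z, dworkEval p ϖ (χ z) ≠ 0 := fun z => norm_ne_zero_iff.mp (by rw [hn]; simp)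
  have key : ‖dworkEval p ϖ (χ (x + y)) - dworkEval p ϖ (χ x) * dworkEval p ϖ (χ y)‖ < ‖ϖ‖ := by
    have e : dworkEval p ϖ (χ (x + y)) - dworkEval p ϖ (χ x) * dworkEval p ϖ (χ y) =
        (((dworkEval p ϖ (χ (x + y)) - (1 + ϖ * χ (x + y))) +
          -(dworkEval p ϖ (χ x) - (1 + ϖ * χ x))) +
          -(dworkEval p ϖ (χ y) - (1 + ϖ * χ y))) +
        (ϖ * (χ (x + y) - χ x - χ y) +
          -((dworkEval p ϖ (χ x) - 1) * (dworkEval p ϖ (χ y) - 1))) := by ring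
    rw [e]
    refine (IsUltrametricDist.norm_add_le_max _ _).trans_lt (max_lt
      ((IsUltrametricDist.norm_add_le_max _ _).trans_lt (max_lt
        ((IsUltrametricDist.norm_add_le_max _ _).trans_lt (max_lt (hE _) ?_)) ?_))
      ((IsUltrametricDist.norm_add_le_max _ _).trans_lt (max_lt ?_ ?_)))
    · rw [norm_neg]; exact hE x
    · rw [norm_neg]; exact hE y
    · rw [norm_mul]; exact mul_lt_of_lt_one_right h0 (hχ x y)
    · rw [norm_neg, norm_mul]
      exact (mul_le_mul (hD x) (hD y) (norm_nonneg _) h0.le).trans_lt (mul_lt_of_lt_one_right h0 h1)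
  have h2 := mul_ne_zero (hne x) (hne y)
  rw [← div_eq_one_iff_eq h2]
  refine eq_one_of_pow_eq_one_of_norm_sub_lt hϖ ?_ ?_
  · rw [div_pow, mul_pow, hψ, hψ, hψ, mul_one, div_one]
  · rw [div_sub_one h2, norm_div, norm_mul, hn, hn, mul_one, div_one]
    exact key

/-- The additive character of the prime field obtained from Dwork's exponential. -/
noncomputable def dworkAddChar (hΓ : IsMoritaGamma p Γ) (hp2 : p ≠ 2) (hϖ : ϖ ^ (p - 1) = -p)
    {χ : MulChar (ZMod p) K} (hχ : ∀ x y, ‖χ (x + y) - χ x - χ y‖ < 1) : AddChar (ZMod p) K where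
  toFun x := dworkEval p ϖ (χ x)
  map_zero_eq_one' := by
    rw [MulChar.map_zero]
    have h := hasSum_dworkEval hΓ hp2 hϖ (t := 0) (by simp)
    have h2 := hasSum_single (f := fun n => coeff n (dworkSeries p ϖ) * (0 : K) ^ n) 0
      fun n hn => by simp [hn]
    rw [h.unique h2]
    simpa using sum_coeff_dworkSeries ϖ (Fact.out : p.Prime).pos 0
  map_add_eq_mul' := dworkEval_add hΓ hp2 hϖ hχ

lemma dworkAddChar_apply (hΓ : IsMoritaGamma p Γ) (hp2 : p ≠ 2) (hϖ : ϖ ^ (p - 1) = -p)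
    {χ : MulChar (ZMod p) K} (hχ : ∀ x y, ‖χ (x + y) - χ x - χ y‖ < 1) (x : ZMod p) :
    dworkAddChar hΓ hp2 hϖ hχ x = dworkEval p ϖ (χ x) := rfl

lemma dworkAddChar_ne_one (hΓ : IsMoritaGamma p Γ) (hp2 : p ≠ 2) (hϖ : ϖ ^ (p - 1) = -p)
    {χ : MulChar (ZMod p) K} (hχ : ∀ x y, ‖χ (x + y) - χ x - χ y‖ < 1) :
    dworkAddChar hΓ hp2 hϖ hχ ≠ 1 := fun h => by
  have h1 := norm_dworkEval_sub_lt hΓ hp2 hϖ (χ.norm_apply_le_one 1)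
  rw [← dworkAddChar_apply hΓ hp2 hϖ hχ, h] at h1
  simp at h1

end DworkCharacter

section GrossKoblitz

open PowerSeries

variable {p : ℕ} [Fact p.Prime] {K : Type*} [NormedField K] {χ : MulChar (ZMod p) K}

lemma MulChar.norm_apply_eq_one [NormedAlgebra ℚ_[p] K] (χ : MulChar (ZMod p) K) {x : ZMod p}
    (hx : x ≠ 0) : ‖χ x‖ = 1 := by
  have hp := (Fact.out : p.Prime)
  have h := congrArg norm (map_pow χ x (p - 1))
  rw [ZMod.pow_card_sub_one_eq_one hx, map_one, norm_one, norm_pow] at h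
  exact (pow_eq_one_iff_of_nonneg (norm_nonneg _) (by have := hp.two_le; lia)).mp h.symm

lemma MulChar.injective_of_norm_sub_lt [NormedAlgebra ℚ_[p] K]
    (hχ : ∀ x y, ‖χ (x + y) - χ x - χ y‖ < 1) : Function.Injective χ := by
  intro x y h
  by_contra hxy
  have h1 := hχ y (x - y)
  rw [add_sub_cancel, h, sub_self, zero_sub, norm_neg,
    χ.norm_apply_eq_one (sub_ne_zero.mpr hxy)] at h1
  exact lt_irrefl _ h1

lemma MulChar.orderOf_eq_of_injective (hχ : Function.Injective χ) : orderOf χ = p - 1 := by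
  have hp := (Fact.out : p.Prime)
  refine Nat.dvd_antisymm ?_ ?_
  · rw [orderOf_dvd_iff_pow_eq_one]
    ext x
    rw [MulChar.pow_apply_coe, ← map_pow, ZMod.pow_card_sub_one_eq_one x.ne_zero, map_one,
      MulChar.one_apply_coe]
  · obtain ⟨g, hg⟩ := IsCyclic.exists_ofOrder_eq_natCard (α := (ZMod p)ˣ)
    rw [Nat.card_eq_fintype_card, ZMod.card_units p] at hg
    rw [← hg, orderOf_dvd_iff_pow_eq_one, Units.ext_iff]
    apply hχ
    rw [Units.val_pow_eq_pow_val, map_pow, ← MulChar.pow_apply_coe, pow_orderOf_eq_one]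
    simp

lemma MulChar.apply_neg_one_of_injective (hp2 : p ≠ 2) (hχ : Function.Injective χ) :
    χ (-1) = -1 := by
  have : Fact (2 < p) := ⟨lt_of_le_of_ne (Fact.out : p.Prime).two_le hp2.symm⟩
  have h1 : χ (-1) ^ 2 = 1 := by rw [← map_pow]; simp
  refine (sq_eq_one_iff.mp h1).resolve_left fun h => ?_
  exact ZMod.neg_one_ne_one (hχ (h.trans (map_one χ).symm))

lemma gaussSum_mul_gaussSum_inv {F K : Type*} [Field F] [Fintype F] [Field K] {χ : MulChar F K}
    (hχ : χ ≠ 1) {ψ : AddChar F K} (hψ : ψ.IsPrimitive) :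
    gaussSum χ ψ * gaussSum χ⁻¹ ψ = χ (-1) * Fintype.card F := by
  rw [← gaussSum_mul_gaussSum_eq_card hχ hψ, ← mul_gaussSum_inv_eq_gaussSum χ⁻¹ ψ,
    MulChar.inv_apply', inv_neg_one]
  ring

variable {Γ : ℤ_[p] → ℤ_[p]} [CharZero K] [NormedAlgebra ℚ_[p] K] [IsUltrametricDist K]
  [CompleteSpace K] {ϖ : K}

lemma gaussSum_dworkAddChar_aux (hΓ : IsMoritaGamma p Γ) (hp2 : p ≠ 2) (hϖ : ϖ ^ (p - 1) = -p)
    (hχ : ∀ x y, ‖χ (x + y) - χ x - χ y‖ < 1) {a : ℕ} (ha0 : 0 < a) (ha : a < p - 1) {σ : ℤ_[p]}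
    (hσ : p * σ = σ + a) :
    gaussSum (χ⁻¹ ^ a) (dworkAddChar hΓ hp2 hϖ hχ) =
      (-1) ^ a * ϖ ^ a / algebraMap ℚ_[p] K (Γ (1 - σ)) := by
  have hp := (Fact.out : p.Prime)
  have hord := MulChar.orderOf_eq_of_injective (MulChar.injective_of_norm_sub_lt hχ)
  have h1 : HasSum (fun n => ∑ x, coeff n (dworkSeries p ϖ) * (χ ^ n * χ⁻¹ ^ a) x)
      (gaussSum (χ⁻¹ ^ a) (dworkAddChar hΓ hp2 hϖ hχ)) := by
    refine hasSum_sum fun x _ => ?_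
    rw [dworkAddChar_apply]
    refine Eq.mpr (congrArg (HasSum · _) (funext fun n => ?_))
      ((hasSum_dworkEval hΓ hp2 hϖ (χ.norm_apply_le_one x)).mul_left ((χ⁻¹ ^ a) x))
    rw [MulChar.mul_apply]
    rcases eq_or_ne x 0 with rfl | hx
    · simp only [MulChar.map_zero, mul_zero, zero_mul]
    · obtain ⟨u, rfl⟩ := hx.isUnit
      rw [MulChar.pow_apply_coe χ n u]
      ring
  have hinj : Function.Injective fun k => (p - 1) * k + a := fun x y h => by
    have h2 : p - 1 ≠ 0 := by lia
    simpa [h2] using h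
  have h2 : ∀ n ∉ Set.range fun k => (p - 1) * k + a,
      ∑ x, coeff n (dworkSeries p ϖ) * (χ ^ n * χ⁻¹ ^ a) x = 0 := by
    intro n hn
    rw [← Finset.mul_sum, MulChar.sum_eq_zero_of_ne_one, mul_zero]
    intro h
    rw [inv_pow, mul_inv_eq_one, pow_eq_pow_iff_modEq, hord] at h
    refine hn ⟨n / (p - 1), ?_⟩
    have h3 : n % (p - 1) = a := Eq.trans h (Nat.mod_eq_of_lt ha)
    have h4 := Nat.div_add_mod n (p - 1)
    rw [h3] at h4
    exact h4
  rw [← hinj.hasSum_iff h2] at h1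
  have h3 := (hasSum_coeff_dworkSeries (K := K) hΓ hp2 hϖ ha0 (by lia) hσ).mul_right ((p : K) - 1)
  have h4 : (p : K) - 1 ≠ 0 := sub_ne_zero.mpr (mod_cast hp.one_lt.ne')
  have h5 : (1 : K) - p ≠ 0 := sub_ne_zero.mpr (mod_cast hp.one_lt.ne)
  have h7 : ∀ k, ∑ x, (χ ^ ((p - 1) * k + a) * χ⁻¹ ^ a) x = (p : K) - 1 := fun k => by
    have h8 : χ ^ ((p - 1) * k + a) * χ⁻¹ ^ a = 1 := by
      rw [inv_pow, mul_inv_eq_one, pow_add, pow_mul, ← hord, pow_orderOf_eq_one, one_pow, one_mul]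
    rw [h8, MulChar.sum_one_eq_card_units, ZMod.card_units, Nat.cast_sub hp.one_le, Nat.cast_one]
  simp only [Function.comp_def, ← Finset.mul_sum, h7] at h1
  rw [h1.unique h3]
  have h6 : (algebraMap ℚ_[p] K) (Γ (1 - σ) : ℚ_[p]) ≠ 0 := by
    rw [map_ne_zero_iff _ (algebraMap ℚ_[p] K).injective]
    exact_mod_cast hΓ.ne_zero _
  field_simp
  ring

theorem gaussSum_dworkAddChar (hΓ : IsMoritaGamma p Γ) (hp2 : p ≠ 2) (hϖ : ϖ ^ (p - 1) = -p)
    (hχ : ∀ x y, ‖χ (x + y) - χ x - χ y‖ < 1) {a : ℕ} (ha : a < p - 1) {σ : ℤ_[p]}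
    (hσ : p * σ = σ + a) :
    gaussSum (χ⁻¹ ^ a) (dworkAddChar hΓ hp2 hϖ hχ) = -(ϖ ^ a * algebraMap ℚ_[p] K (Γ σ)) := by
  have hp := (Fact.out : p.Prime)
  have hinj := MulChar.injective_of_norm_sub_lt hχ
  have hord := MulChar.orderOf_eq_of_injective hinj
  have hne := dworkAddChar_ne_one hΓ hp2 hϖ hχ
  rcases Nat.eq_zero_or_pos a with rfl | ha0
  · have h1 : σ = 0 := by
      have h2 : ((p : ℤ_[p]) - 1) * σ = 0 := by linear_combination hσ
      refine (mul_eq_zero.mp h2).resolve_left (sub_ne_zero.mpr (mod_cast hp.one_lt.ne'))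
    rw [pow_zero, gaussSum_one_left hne, h1, hΓ.map_zero]
    simp
  · have h1 := gaussSum_dworkAddChar_aux hΓ hp2 hϖ hχ (a := p - 1 - a) (by lia) (by lia)
      (σ := 1 - σ) (by
        rw [Nat.cast_sub (by lia), Nat.cast_sub hp.one_le]
        linear_combination -hσ)
    rw [sub_sub_cancel] at h1
    have h2 : χ⁻¹ ^ (p - 1 - a) = (χ⁻¹ ^ a)⁻¹ := by
      rw [_root_.eq_inv_iff_mul_eq_one, ← pow_add, Nat.sub_add_cancel ha.le, inv_pow, ← hord,
        pow_orderOf_eq_one, inv_one]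
    have h3 : χ⁻¹ ^ a ≠ 1 := by
      rw [inv_pow, inv_ne_one, Ne, ← orderOf_dvd_iff_pow_eq_one, hord]
      exact Nat.not_dvd_of_pos_of_lt ha0 ha
    have h4 := gaussSum_mul_gaussSum_inv h3 (AddChar.IsPrimitive.of_ne_one hne)
    have h5 : (χ⁻¹ ^ a) (-1) = (-1) ^ a := by
      have := MulChar.pow_apply_coe χ⁻¹ a (-1)
      rw [MulChar.inv_apply', Units.val_neg, Units.val_one, inv_neg_one,
        χ.apply_neg_one_of_injective hp2 hinj] at this
      exact this
    have h6 : ((-1 : K)) ^ (p - 1 - a) = (-1) ^ a := by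
      have h7 : Even (p - 1) := hp.even_sub_one hp2
      rcases Nat.even_or_odd a with h8 | h8
      · rw [h8.neg_one_pow, (Nat.even_sub ha.le |>.mpr (by simp [h7, h8])).neg_one_pow]
      · rw [h8.neg_one_pow, (Nat.Even.sub_odd ha.le h7 h8).neg_one_pow]
    have h7 : (algebraMap ℚ_[p] K) (Γ σ : ℚ_[p]) ≠ 0 := by
      rw [map_ne_zero_iff _ (algebraMap ℚ_[p] K).injective]
      exact_mod_cast hΓ.ne_zero _
    have h8 := uniformizer_ne_zero hϖ
    have h9 : ϖ ^ (p - 1 - a) * ϖ ^ a = -p := by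
      rw [← pow_add, Nat.sub_add_cancel ha.le, hϖ]
    rw [← h2, h1, h5, h6, ZMod.card] at h4
    rw [mul_div_assoc', div_eq_iff h7] at h4
    apply mul_right_cancel₀ (mul_ne_zero (pow_ne_zero (p - 1 - a) h8)
      (pow_ne_zero a (neg_ne_zero.mpr (one_ne_zero (α := K)))))
    linear_combination h4 + (-1) ^ a * algebraMap ℚ_[p] K (Γ σ) * h9

end GrossKoblitz

section QuadraticCharacter

variable {F K : Type*} [Field F] [Fintype F] [DecidableEq F] [Field K]

/-- The quadratic character of `F` with values in a field `K` of characteristic zero. -/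
abbrev quadraticMulChar (F K : Type*) [Field F] [Fintype F] [DecidableEq F] [Field K] :
    MulChar F K := (quadraticChar F).ringHomComp (Int.castRingHom K)

lemma quadraticMulChar_apply (x : F) : quadraticMulChar F K x = (quadraticChar F x : ℤ) := rfl

lemma MulChar.eq_one_or_eq_quadraticMulChar {A : MulChar F K} (hA : A ^ 2 = 1) :
    A = 1 ∨ A = quadraticMulChar F K := by
  have hsq : ∀ u : Fˣ, A u ^ 2 = 1 := fun u => by
    rw [← MulChar.pow_apply_coe, hA, MulChar.one_apply_coe]
  have hs : ∀ u : Fˣ, quadraticChar F u = 1 → A u = 1 := fun u hu => by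
    obtain ⟨y, hy⟩ := (quadraticChar_one_iff_isSquare u.ne_zero).mp hu
    have hy0 : y ≠ 0 := by
      rintro rfl
      simp at hy
    rw [hy, map_mul, ← sq]
    exact hsq (Units.mk0 y hy0)
  refine or_iff_not_imp_left.mpr fun h1 => ?_
  obtain ⟨u, hu⟩ := MulChar.ne_one_iff.mp h1
  have hu1 : quadraticChar F u = -1 :=
    (quadraticChar_dichotomy u.ne_zero).resolve_left fun h => hu (hs u h)
  have hu2 : A u = -1 := (sq_eq_one_iff.mp (hsq u)).resolve_left hu
  ext x
  rcases quadraticChar_dichotomy x.ne_zero with hx | hx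
  · rw [hs x hx, quadraticMulChar_apply, hx, Int.cast_one]
  · have h2 := hs (x * u) (by rw [Units.val_mul, map_mul, hx, hu1]; rfl)
    rw [Units.val_mul, map_mul, hu2] at h2
    rw [quadraticMulChar_apply, hx, Int.cast_neg, Int.cast_one]
    linear_combination -h2

lemma sum_comp_sq (hF : ringChar F ≠ 2) (f : F → K) :
    ∑ u, f (u ^ 2) = ∑ v, f v * (1 + quadraticMulChar F K v) := by
  rw [← Finset.sum_fiberwise_of_maps_to (g := fun u : F => u ^ 2) (t := Finset.univ)
    fun _ _ => Finset.mem_univ _]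
  refine Finset.sum_congr rfl fun v _ => ?_
  rw [Finset.sum_congr rfl (g := fun _ => f v) fun u hu => by rw [(Finset.mem_filter.mp hu).2],
    Finset.sum_const, nsmul_eq_mul, mul_comm]
  have h := quadraticChar_card_sqrts hF v
  rw [quadraticMulChar_apply, add_comm, ← Int.cast_one, ← Int.cast_add, ← h, Int.cast_natCast]
  congr 3
  ext u
  simp

lemma jacobiSum_self (hF : ringChar F ≠ 2) {A : MulChar F K} (hA : A ≠ 1) :
    jacobiSum A A = A⁻¹ 4 * jacobiSum A (quadraticMulChar F K) := by
  have h2 : (2 : F) ≠ 0 := Ring.two_ne_zero hF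
  let e : F ≃ F := (Equiv.addLeft 1).trans (Equiv.mulRight₀ 2⁻¹ (inv_ne_zero h2))
  have h4 : (4 : F) ≠ 0 := by
    have := mul_ne_zero h2 h2
    norm_num at this
    exact this
  rw [jacobiSum, ← e.sum_comp]
  have h5 : ∀ u, A (e u) * A (1 - e u) = A⁻¹ 4 * A (1 - u ^ 2) := fun u => by
    rw [MulChar.inv_apply', ← map_mul, ← map_mul]
    congr 1
    simp only [e, Equiv.trans_apply, Equiv.coe_addLeft, Equiv.mulRight₀_apply]
    field_simp
    ring
  simp_rw [h5, ← Finset.mul_sum]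
  congr 1
  rw [sum_comp_sq hF fun v => A (1 - v), jacobiSum_comm, jacobiSum]
  simp_rw [mul_add, mul_one, Finset.sum_add_distrib]
  rw [show ∑ x, A (1 - x) = ∑ x, A x from (Equiv.subLeft (1 : F)).sum_comp A,
    MulChar.sum_eq_zero_of_ne_one hA, zero_add]
  simp_rw [mul_comm]

variable [CharZero K]

lemma quadraticMulChar_sq {x : F} (hx : x ≠ 0) : quadraticMulChar F K x ^ 2 = 1 := by
  rw [quadraticMulChar_apply]
  exact_mod_cast quadraticChar_sq_one hx

lemma quadraticMulChar_inv : (quadraticMulChar F K)⁻¹ = quadraticMulChar F K := by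
  refine inv_eq_of_mul_eq_one_right (MulChar.ext fun u => ?_)
  rw [MulChar.mul_apply, ← sq, quadraticMulChar_sq u.ne_zero, MulChar.one_apply_coe]

lemma quadraticMulChar_ne_one (hF : ringChar F ≠ 2) : quadraticMulChar F K ≠ 1 := by
  obtain ⟨a, ha⟩ := quadraticChar_exists_neg_one' hF
  intro h
  have h1 := DFunLike.congr_fun h (a : F)
  rw [quadraticMulChar_apply, ha, MulChar.one_apply_coe] at h1
  norm_num at h1

/-- The Hasse–Davenport duplication formula. -/
theorem gaussSum_mul_gaussSum_quadraticMulChar (hF : ringChar F ≠ 2) (A : MulChar F K)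
    {ψ : AddChar F K} (hψ : ψ.IsPrimitive) :
    gaussSum A ψ * gaussSum (A * quadraticMulChar F K) ψ =
      A⁻¹ 4 * gaussSum (A ^ 2) ψ * gaussSum (quadraticMulChar F K) ψ := by
  have h2 : (2 : F) ≠ 0 := Ring.two_ne_zero hF
  have h4 : (4 : F) = 2 ^ 2 := by norm_num
  have h5 : ((2 : F) ^ 2) ≠ 0 := pow_ne_zero 2 h2
  by_cases hA : A ^ 2 = 1
  · rcases MulChar.eq_one_or_eq_quadraticMulChar hA with rfl | rfl
    · rw [one_mul, one_pow, inv_one, h4, MulChar.one_apply h5.isUnit, one_mul]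
    · rw [quadraticMulChar_inv, h4, map_pow, quadraticMulChar_sq h2, hA, ← sq, hA]
      ring
  · have hA1 : A ≠ 1 := fun h => hA (by rw [h, one_pow])
    have hA2 : A * quadraticMulChar F K ≠ 1 := fun h => by
      rw [mul_eq_one_iff_eq_inv, quadraticMulChar_inv] at h
      refine hA (MulChar.ext fun u => ?_)
      rw [h, MulChar.pow_apply_coe, quadraticMulChar_sq u.ne_zero, MulChar.one_apply_coe]
    have h6 := jacobiSum_mul_nontrivial (sq A ▸ hA) ψ
    have h7 := jacobiSum_mul_nontrivial hA2 ψ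
    rw [jacobiSum_self hF hA1, ← sq] at h6
    have h8 : gaussSum A ψ ≠ 0 := gaussSum_ne_zero_of_nontrivial (by simp) hA1 hψ
    apply mul_left_cancel₀ h8
    linear_combination -gaussSum (A * quadraticMulChar F K) ψ * h6 +
      A⁻¹ 4 * gaussSum (A ^ 2) ψ * h7

end QuadraticCharacter

section Counting

variable {F K : Type*} [Field F] [Fintype F] [DecidableEq F] [Field K]

lemma sum_eq_add_sum_units (f : F → K) : ∑ x, f x = f 0 + ∑ u : Fˣ, f u := by
  rw [Fintype.sum_eq_add_sum_subtype_ne f 0, ← unitsEquivNeZero.sum_comp]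
  simp

lemma gaussSum_eq_sum_units (A : MulChar F K) (ψ : AddChar F K) :
    gaussSum A ψ = ∑ u : Fˣ, A u * ψ u := by
  rw [gaussSum, sum_eq_add_sum_units, MulChar.map_zero, zero_mul, zero_add]

lemma sum_pow_apply_eq_ite {χ : MulChar F K} (hχ : Function.Injective χ) (u : Fˣ) :
    ∑ j ∈ Finset.range (Fintype.card Fˣ), χ u ^ j = if u = 1 then (Fintype.card Fˣ : K) else 0 := by
  split_ifs with h
  · simp [h]
  · have h1 : χ u ≠ 1 := fun h2 => h (Units.ext (hχ (by rw [h2, Units.val_one, map_one])))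
    have h2 := mul_geom_sum (χ u) (Fintype.card Fˣ)
    rw [← map_pow, ← Units.val_pow_eq_pow_val, pow_card_eq_one, Units.val_one, map_one,
      sub_self] at h2
    exact (mul_eq_zero.mp h2).resolve_left (sub_ne_zero.mpr h1)

variable [CharZero K]

lemma gaussSum_mul_quadraticMulChar (hF : ringChar F ≠ 2) (ψ : AddChar F K) (u : F) :
    gaussSum (quadraticMulChar F K) ψ * quadraticMulChar F K u =
      ∑ s : Fˣ, quadraticMulChar F K s * ψ (s * u) := by
  rcases eq_or_ne u 0 with rfl | hu
  · have h := gaussSum_one_right (quadraticMulChar_ne_one (F := F) (K := K) hF)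
    rw [gaussSum_eq_sum_units] at h
    simpa using h.symm
  · have h := gaussSum_mulShift_eq (quadraticMulChar F K) ψ (Units.mk0 u hu)
    rw [gaussSum_eq_sum_units (ψ := ψ.mulShift _), quadraticMulChar_inv, Units.val_mk0] at h
    rw [mul_comm, ← h]
    simp_rw [AddChar.mulShift_apply, mul_comm u]

theorem sum_gaussSum_mul_eq (hF : ringChar F ≠ 2) {χ : MulChar F K} (hχ : Function.Injective χ)
    (ψ : AddChar F K) (a b : Fˣ) :
    ∑ j ∈ Finset.range (Fintype.card Fˣ), gaussSum (χ ^ j) ψ * gaussSum (χ⁻¹ ^ (3 * j)) ψ *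
        gaussSum (χ ^ (2 * j) * quadraticMulChar F K) ψ * χ⁻¹ (b ^ 2 / a ^ 3 : F) ^ j =
      Fintype.card Fˣ * gaussSum (quadraticMulChar F K) ψ *
        (quadraticMulChar F K b * ∑ x, quadraticMulChar F K (x ^ 3 + a * x + b) - 1) := by
  set φ := quadraticMulChar F K with hφ
  have h1 : ∀ j, gaussSum (χ ^ j) ψ * gaussSum (χ⁻¹ ^ (3 * j)) ψ * gaussSum (χ ^ (2 * j) * φ) ψ *
      χ⁻¹ (b ^ 2 / a ^ 3 : F) ^ j = ∑ w : Fˣ, ∑ z : Fˣ, ∑ y : Fˣ,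
        φ w * ψ (y + z + w) * χ ((y * (z ^ 3)⁻¹ * w ^ 2 * (b ^ 2 / a ^ 3)⁻¹ : Fˣ)) ^ j :=
      fun j => by
    simp_rw [gaussSum_eq_sum_units, MulChar.mul_apply, MulChar.pow_apply_coe]
    rw [Finset.sum_mul_sum, Finset.sum_comm, Finset.mul_sum, Finset.sum_mul]
    refine Finset.sum_congr rfl fun w _ => ?_
    rw [Finset.sum_mul, Finset.sum_mul]
    refine Finset.sum_congr rfl fun z _ => ?_
    rw [Finset.sum_mul, Finset.sum_mul]
    refine Finset.sum_congr rfl fun y _ => ?_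
    simp only [MulChar.inv_apply', AddChar.map_add_eq_mul, Units.val_mul, map_mul,
      Units.val_inv_eq_inv_val, Units.val_div_eq_div_val, Units.val_pow_eq_pow_val, map_pow,
      ← inv_pow (z : F)]
    ring
  have h2 : ∀ w z y : Fˣ, y * (z ^ 3)⁻¹ * w ^ 2 * (b ^ 2 / a ^ 3)⁻¹ = 1 ↔
      y = z ^ 3 * (w ^ 2)⁻¹ * (b ^ 2 / a ^ 3) := fun w z y => by
    rw [mul_inv_eq_one, ← eq_mul_inv_iff_mul_eq, mul_inv_eq_iff_eq_mul]
    rw [show b ^ 2 / a ^ 3 * (w ^ 2)⁻¹ * z ^ 3 = z ^ 3 * (w ^ 2)⁻¹ * (b ^ 2 / a ^ 3) by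
      rw [mul_comm, mul_comm (b ^ 2 / a ^ 3), mul_assoc]]
  simp_rw [h1]
  rw [Finset.sum_comm]
  have h3 : ∀ w : Fˣ, ∑ j ∈ Finset.range (Fintype.card Fˣ), ∑ z : Fˣ, ∑ y : Fˣ,
      φ w * ψ (y + z + w) * χ ((y * (z ^ 3)⁻¹ * w ^ 2 * (b ^ 2 / a ^ 3)⁻¹ : Fˣ)) ^ j =
      Fintype.card Fˣ * ∑ z : Fˣ,
        φ w * ψ ((z ^ 3 * (w ^ 2)⁻¹ * (b ^ 2 / a ^ 3) : Fˣ) + z + w) := fun w => by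
    rw [Finset.sum_comm, Finset.mul_sum]
    refine Finset.sum_congr rfl fun z _ => ?_
    rw [Finset.sum_comm]
    simp_rw [← Finset.mul_sum, sum_pow_apply_eq_ite hχ, h2]
    simp only [mul_ite, mul_zero, Finset.sum_ite_eq', Finset.mem_univ, if_true]
    ring
  simp_rw [h3]
  rw [← Finset.mul_sum, mul_assoc]
  congr 1
  have h4 : gaussSum φ ψ * (φ b * ∑ x, φ (x ^ 3 + a * x + b) - 1) =
      φ b * ∑ x : Fˣ, gaussSum φ ψ * φ (x ^ 3 + a * x + b) := by
    rw [sum_eq_add_sum_units, ← Finset.mul_sum]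
    have := quadraticMulChar_sq (K := K) b.ne_zero
    simp only [mul_zero, zero_add, ne_eq, OfNat.ofNat_ne_zero, not_false_eq_true, zero_pow]
    linear_combination gaussSum φ ψ * this
  rw [h4]
  simp_rw [hφ, gaussSum_mul_quadraticMulChar hF, ← hφ]
  conv_rhs => rw [Finset.sum_comm, Finset.mul_sum]
  rw [← Equiv.sum_comp (Equiv.mulRight b)]
  refine Finset.sum_congr rfl fun s _ => ?_
  rw [Finset.mul_sum, ← Equiv.sum_comp (Equiv.mulLeft (s * a))]
  refine Finset.sum_congr rfl fun x _ => ?_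
  simp only [Equiv.coe_mulRight, Equiv.coe_mulLeft, Units.val_mul, map_mul,
    Units.val_inv_eq_inv_val, Units.val_div_eq_div_val, Units.val_pow_eq_pow_val]
  rw [← mul_assoc, mul_comm (φ b)]
  congr 2
  have ha := a.ne_zero
  have hb := b.ne_zero
  have hs := s.ne_zero
  field_simp

end Counting

section FractionalParts

variable {p : ℕ} [Fact p.Prime]

lemma toZp_mul_eq {q : ℚ} {r : ℕ} (hq : ((p : ℚ) - 1) * q = r) : p * toZp p q = toZp p q + r := by
  have hp := (Fact.out : p.Prime)
  have h1 : ((p : ℚ_[p]) - 1) * q = r := by exact_mod_cast congrArg (Rat.cast : ℚ → ℚ_[p]) hq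
  have h2 : ‖(p : ℚ_[p]) - 1‖ = 1 := by
    have h3 : ‖(p : ℚ_[p])‖ < 1 := Padic.norm_p_lt_one
    rw [sub_eq_add_neg, IsUltrametricDist.norm_add_eq_max_of_norm_ne_norm] <;>
      rw [norm_neg, norm_one]
    · exact max_eq_right h3.le
    · exact h3.ne
  have h3 : ‖(q : ℚ_[p])‖ ≤ 1 := by
    have h5 := congrArg norm h1
    rw [norm_mul, h2, one_mul] at h5
    rw [h5]
    have h4 := Padic.norm_int_le_one (p := p) (r : ℤ)
    rwa [Int.cast_natCast] at h4
  have h4 : (toZp p q : ℚ_[p]) = q := by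
    rw [toZp]
    exact congrArg PadicInt.Coe.ringHom (dif_pos h3)
  apply PadicInt.ext
  push_cast
  rw [h4]
  linear_combination h1

variable {Γ : ℤ_[p] → ℤ_[p]} {K : Type*} [NormedField K] [CharZero K] [NormedAlgebra ℚ_[p] K]
  [IsUltrametricDist K] [CompleteSpace K] {ϖ : K} {χ : MulChar (ZMod p) K}

/-- The Gross–Koblitz formula over the prime field. -/
theorem gaussSum_dworkAddChar_zpow (hΓ : IsMoritaGamma p Γ) (hp2 : p ≠ 2) (hϖ : ϖ ^ (p - 1) = -p)
    (hχ : ∀ x y, ‖χ (x + y) - χ x - χ y‖ < 1) (n : ℤ) :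
    gaussSum (χ ^ (-n)) (dworkAddChar hΓ hp2 hϖ hχ) =
      -(ϖ ^ n * (-p) ^ (-⌊(n : ℚ) / ((p : ℚ) - 1)⌋) *
        algebraMap ℚ_[p] K (Γ (toZp p (Int.fract ((n : ℚ) / ((p : ℚ) - 1)))))) := by
  have hp := (Fact.out : p.Prime)
  have hN : (0 : ℚ) < (p : ℚ) - 1 := sub_pos.mpr (mod_cast hp.one_lt)
  have hNc : ((p - 1 : ℕ) : ℤ) = (p : ℤ) - 1 := by rw [Nat.cast_sub hp.one_le, Nat.cast_one]
  set f := ⌊(n : ℚ) / ((p : ℚ) - 1)⌋ with hf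
  have h1 : ((p : ℚ) - 1) * Int.fract ((n : ℚ) / ((p : ℚ) - 1)) = ((n - (p - 1) * f : ℤ) : ℚ) := by
    rw [Int.fract, ← hf, mul_sub, mul_div_cancel₀ _ hN.ne']
    push_cast
    ring
  have h2 : 0 ≤ n - (p - 1) * f := by
    have := mul_nonneg hN.le (Int.fract_nonneg ((n : ℚ) / ((p : ℚ) - 1)))
    rw [h1] at this
    exact_mod_cast this
  have h3 : n - (p - 1) * f < p - 1 := by
    have := mul_lt_of_lt_one_right hN (Int.fract_lt_one ((n : ℚ) / ((p : ℚ) - 1)))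
    rw [h1] at this
    exact_mod_cast this
  obtain ⟨r, hr⟩ := Int.eq_ofNat_of_zero_le h2
  have h4 := gaussSum_dworkAddChar hΓ hp2 hϖ hχ (a := r) (by lia)
    (toZp_mul_eq (by rw [h1, hr, Int.cast_natCast]))
  have hn : n = (p - 1 : ℕ) * f + r := by rw [hNc, ← hr]; ring
  have h5 : χ ^ (-n) = χ⁻¹ ^ r := by
    rw [zpow_neg, hn, zpow_add, zpow_mul, zpow_natCast, ← MulChar.orderOf_eq_of_injective
      (MulChar.injective_of_norm_sub_lt hχ), pow_orderOf_eq_one, one_zpow, one_mul, zpow_natCast,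
      inv_pow]
  have h6 : ϖ ^ n * (-p) ^ (-f) = ϖ ^ r := by
    have h7 : (-p : K) ≠ 0 := neg_ne_zero.mpr (Nat.cast_ne_zero.mpr hp.ne_zero)
    rw [hn, zpow_add₀ (uniformizer_ne_zero hϖ), zpow_mul, zpow_natCast, hϖ, zpow_natCast,
      mul_right_comm, ← zpow_add₀ h7, add_neg_cancel, zpow_zero, one_mul]
  rw [h5, h4, h6]

end FractionalParts

section Teichmuller

variable {p : ℕ} [Fact p.Prime]

lemma exists_mulChar_eq_teichmuller {ω : ZMod p → ℤ_[p]} (hω0 : ω 0 = 0)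
    (hωmul : ∀ x y : ZMod p, ω (x * y) = ω x * ω y) (hωunit : ∀ x : ZMod p, x ≠ 0 → IsUnit (ω x)) :
    ∃ χ : MulChar (ZMod p) ℚ_[p], ∀ x, χ x = ω x := by
  have h1 : ω 1 = 1 := by
    have h := hωmul 1 1
    rw [mul_one] at h
    exact (mul_eq_left₀ (hωunit 1 one_ne_zero).ne_zero).mp h.symm
  refine ⟨⟨⟨⟨fun x => (ω x : ℚ_[p]), ?_⟩, ?_⟩, ?_⟩, fun x => rfl⟩
  · simp [h1]
  · simp [hωmul]
  · intro x hx
    simp only [isUnit_iff_ne_zero, ne_eq, not_not] at hx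
    simp [hx, hω0]

lemma norm_teichmuller_add_sub_lt {ω : ZMod p → ℤ_[p]}
    (hω : ∀ x : ZMod p, (p : ℤ_[p]) ∣ (ω x - (x.val : ℤ_[p]))) (x y : ZMod p) :
    ‖ω (x + y) - ω x - ω y‖ < 1 := by
  rw [PadicInt.norm_lt_one_iff_dvd]
  have h1 : (p : ℤ) ∣ ((x + y).val : ℤ) - x.val - y.val := by
    rw [← ZMod.intCast_zmod_eq_zero_iff_dvd]
    simp
  have h2 : (p : ℤ_[p]) ∣ ((x + y).val : ℤ_[p]) - x.val - y.val := by
    exact_mod_cast map_dvd (Int.castRingHom ℤ_[p]) h1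
  convert dvd_add h2 (dvd_sub (dvd_sub (hω (x + y)) (hω x)) (hω y)) using 1
  ring

end Teichmuller

lemma card_filter_sq_eq {F K : Type*} [Field F] [Fintype F] [DecidableEq F] [Field K] [CharZero K]
    (hF : ringChar F ≠ 2) (f : F → F) :
    ((Finset.univ.filter fun xy : F × F => xy.2 ^ 2 = f xy.1).card : K) =
      Fintype.card F + ∑ x, quadraticMulChar F K (f x) := by
  rw [Finset.card_filter, Fintype.sum_prod_type, Nat.cast_sum]
  have h : ∀ x, ((∑ y, if y ^ 2 = f x then 1 else 0 : ℕ) : K) =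
      1 + quadraticMulChar F K (f x) := fun x => by
    have h1 := sum_comp_sq (K := K) hF fun v => if v = f x then 1 else 0
    push_cast
    rw [h1]
    simp
  simp_rw [h]
  rw [Finset.sum_add_distrib]
  simp

theorem elliptic_trace_formula {p : ℕ} [Fact p.Prime] {Γ : ℤ_[p] → ℤ_[p]} {K : Type*}
    [NormedField K] [CharZero K] [NormedAlgebra ℚ_[p] K] [IsUltrametricDist K] [CompleteSpace K]
    {ϖ : K} {χ : MulChar (ZMod p) K} (hΓ : IsMoritaGamma p Γ) (hp2 : p ≠ 2) (hϖ : ϖ ^ (p - 1) = -p)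
    (hχ : ∀ x y, ‖χ (x + y) - χ x - χ y‖ < 1) {a b : ZMod p} (ha : a ≠ 0) (hb : b ≠ 0) :
    (p - (Finset.univ.filter
      fun xy : ZMod p × ZMod p => xy.2 ^ 2 = xy.1 ^ 3 + a * xy.1 + b).card : K) =
      (-quadraticMulChar (ZMod p) K b * p / (p - 1)) *
        (1 - ∑ j ∈ Finset.Ico 1 (p - 1),
          (-p : K) ^ (⌊((-2 * j : ℤ) : ℚ) / ((p : ℚ) - 1)⌋ - ⌊((-j : ℤ) : ℚ) / ((p : ℚ) - 1)⌋ -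
            ⌊((3 * j : ℤ) : ℚ) / ((p : ℚ) - 1)⌋ - ⌊((-4 * j : ℤ) : ℚ) / ((p : ℚ) - 1)⌋ - 1) *
            (algebraMap ℚ_[p] K (Γ (toZp p (Int.fract (((-j : ℤ) : ℚ) / ((p : ℚ) - 1))))) *
              algebraMap ℚ_[p] K (Γ (toZp p (Int.fract (((3 * j : ℤ) : ℚ) / ((p : ℚ) - 1))))) *
              algebraMap ℚ_[p] K (Γ (toZp p (Int.fract (((-4 * j : ℤ) : ℚ) / ((p : ℚ) - 1))))) /
              algebraMap ℚ_[p] K (Γ (toZp p (Int.fract (((-2 * j : ℤ) : ℚ) / ((p : ℚ) - 1)))))) *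
            (χ (16 * b ^ 2 / a ^ 3))⁻¹ ^ j) := by
  have hp := (Fact.out : p.Prime)
  have hF : ringChar (ZMod p) ≠ 2 := by rwa [ZMod.ringChar_zmod_n]
  set ψ := dworkAddChar hΓ hp2 hϖ hχ with hψ
  have hψ1 : ψ ≠ 1 := dworkAddChar_ne_one hΓ hp2 hϖ hχ
  have hψp : ψ.IsPrimitive := AddChar.IsPrimitive.of_ne_one hψ1
  set φ := quadraticMulChar (ZMod p) K with hφ
  have hp0 : (p : K) ≠ 0 := Nat.cast_ne_zero.mpr hp.ne_zero
  have hp1 : (p : K) - 1 ≠ 0 := sub_ne_zero.mpr (mod_cast hp.one_lt.ne')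
  have hϖ0 := uniformizer_ne_zero hϖ
  have hg : gaussSum φ ψ ≠ 0 :=
    gaussSum_ne_zero_of_nontrivial (by simpa using hp.ne_zero) (quadraticMulChar_ne_one hF) hψp
  have hΓ0 : ∀ x, algebraMap ℚ_[p] K (Γ x) ≠ 0 := fun x => by
    rw [map_ne_zero_iff _ (algebraMap ℚ_[p] K).injective]
    exact_mod_cast hΓ.ne_zero _
  have key : ∀ j : ℕ, (-p : K) ^ (⌊((-2 * j : ℤ) : ℚ) / ((p : ℚ) - 1)⌋ -
      ⌊((-j : ℤ) : ℚ) / ((p : ℚ) - 1)⌋ - ⌊((3 * j : ℤ) : ℚ) / ((p : ℚ) - 1)⌋ -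
      ⌊((-4 * j : ℤ) : ℚ) / ((p : ℚ) - 1)⌋ - 1) *
      (algebraMap ℚ_[p] K (Γ (toZp p (Int.fract (((-j : ℤ) : ℚ) / ((p : ℚ) - 1))))) *
        algebraMap ℚ_[p] K (Γ (toZp p (Int.fract (((3 * j : ℤ) : ℚ) / ((p : ℚ) - 1))))) *
        algebraMap ℚ_[p] K (Γ (toZp p (Int.fract (((-4 * j : ℤ) : ℚ) / ((p : ℚ) - 1))))) /
        algebraMap ℚ_[p] K (Γ (toZp p (Int.fract (((-2 * j : ℤ) : ℚ) / ((p : ℚ) - 1)))))) *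
      (χ (16 * b ^ 2 / a ^ 3))⁻¹ ^ j =
      (-p * gaussSum φ ψ)⁻¹ * (gaussSum (χ ^ j) ψ * gaussSum (χ⁻¹ ^ (3 * j)) ψ *
        gaussSum (χ ^ (2 * j) * φ) ψ * χ⁻¹ (b ^ 2 / a ^ 3) ^ j) := fun j => by
    have h1 := gaussSum_dworkAddChar_zpow hΓ hp2 hϖ hχ (-j : ℤ)
    have h2 := gaussSum_dworkAddChar_zpow hΓ hp2 hϖ hχ (3 * j : ℤ)
    have h3 := gaussSum_dworkAddChar_zpow hΓ hp2 hϖ hχ (-4 * j : ℤ)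
    have h4 := gaussSum_dworkAddChar_zpow hΓ hp2 hϖ hχ (-2 * j : ℤ)
    rw [← hψ] at h1 h2 h3 h4
    rw [neg_neg, zpow_natCast] at h1
    have h2' : χ ^ (-(3 * j : ℤ)) = χ⁻¹ ^ (3 * j) := by
      rw [zpow_neg, inv_pow, ← zpow_natCast]
      push_cast
      rfl
    rw [h2'] at h2
    rw [show -(-4 * j : ℤ) = ((2 * j * 2 : ℕ) : ℤ) by push_cast; ring, zpow_natCast, pow_mul] at h3
    rw [show -(-2 * j : ℤ) = ((2 * j : ℕ) : ℤ) by push_cast; ring, zpow_natCast] at h4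
    have h5 := gaussSum_mul_gaussSum_quadraticMulChar hF (χ ^ (2 * j)) hψp
    rw [← hφ] at h5
    have h4' : gaussSum (χ ^ (2 * j)) ψ ≠ 0 := by
      rw [h4]
      exact neg_ne_zero.mpr (mul_ne_zero (mul_ne_zero (zpow_ne_zero _ hϖ0)
        (zpow_ne_zero _ (neg_ne_zero.mpr hp0))) (hΓ0 _))
    rw [mul_comm, ← eq_div_iff h4'] at h5
    have h6 : (χ (16 * b ^ 2 / a ^ 3))⁻¹ ^ j =
        (χ ^ (2 * j))⁻¹ 4 * χ⁻¹ (b ^ 2 / a ^ 3) ^ j := by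
      have h7 : (4 : ZMod p) ≠ 0 := by
        have h8 := pow_ne_zero 2 (Ring.two_ne_zero hF)
        norm_num at h8
        exact h8
      have h8 := MulChar.pow_apply_coe χ⁻¹ (2 * j) (Units.mk0 4 h7)
      rw [Units.val_mk0] at h8
      rw [← inv_pow χ, h8, pow_mul, ← mul_pow, ← map_pow, ← map_mul, ← MulChar.inv_apply_eq_inv']
      congr 2
      ring
    have h9 : ϖ ^ (-2 * j : ℤ) = ϖ ^ (-j : ℤ) * ϖ ^ (3 * j : ℤ) * ϖ ^ (-4 * j : ℤ) := by
      rw [← zpow_add₀ hϖ0, ← zpow_add₀ hϖ0]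
      congr 1
      ring
    have hp' : (-p : K) ≠ 0 := neg_ne_zero.mpr hp0
    rw [h5, h6, h1, h2, h3, h4, h9]
    simp only [zpow_sub₀ hp', zpow_neg (-p : K), zpow_one]
    have hx (f : ℤ) : (-p : K) ^ f ≠ 0 := zpow_ne_zero f hp'
    have hy (f : ℤ) : ϖ ^ f ≠ 0 := zpow_ne_zero f hϖ0
    have hx1 := hx ⌊((-j : ℤ) : ℚ) / ((p : ℚ) - 1)⌋
    have hx2 := hx ⌊((3 * j : ℤ) : ℚ) / ((p : ℚ) - 1)⌋
    have hx3 := hx ⌊((-4 * j : ℤ) : ℚ) / ((p : ℚ) - 1)⌋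
    have hx4 := hx ⌊((-2 * j : ℤ) : ℚ) / ((p : ℚ) - 1)⌋
    have hy1 := hy (-j : ℤ)
    have hy2 := hy (3 * j : ℤ)
    have hy3 := hy (-4 * j : ℤ)
    have hz := hΓ0 (toZp p (Int.fract (((-2 * j : ℤ) : ℚ) / ((p : ℚ) - 1))))
    generalize (-p : K) ^ ⌊((-j : ℤ) : ℚ) / ((p : ℚ) - 1)⌋ = x1 at *
    generalize (-p : K) ^ ⌊((3 * j : ℤ) : ℚ) / ((p : ℚ) - 1)⌋ = x2 at *
    generalize (-p : K) ^ ⌊((-4 * j : ℤ) : ℚ) / ((p : ℚ) - 1)⌋ = x3 at *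
    generalize (-p : K) ^ ⌊((-2 * j : ℤ) : ℚ) / ((p : ℚ) - 1)⌋ = x4 at *
    generalize ϖ ^ (-j : ℤ) = y1 at *
    generalize ϖ ^ (3 * j : ℤ) = y2 at *
    generalize ϖ ^ (-4 * j : ℤ) = y3 at *
    field_simp
  simp_rw [key]
  rw [← Finset.mul_sum]
  have hsum := sum_gaussSum_mul_eq hF (MulChar.injective_of_norm_sub_lt hχ) ψ (Units.mk0 a ha)
    (Units.mk0 b hb)
  rw [ZMod.card_units, Finset.range_eq_Ico,
    Finset.sum_eq_sum_Ico_succ_bot (by have := hp.two_le; lia),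
    Nat.cast_sub hp.one_le, Nat.cast_one] at hsum
  simp only [pow_zero, mul_zero, one_mul, mul_one, gaussSum_one_left hψ1, Units.val_mk0, zero_add,
    neg_mul_neg] at hsum
  rw [← hφ] at hsum
  rw [card_filter_sq_eq (K := K) hF fun x => x ^ 3 + a * x + b, ZMod.card, ← hφ,
    eq_sub_of_add_eq' hsum]
  have hb2 := quadraticMulChar_sq (K := K) hb
  rw [← hφ] at hb2
  generalize ∑ x, φ (x ^ 3 + a * x + b) = S
  field_simp
  linear_combination (p - 1) * S * hb2

/-- **Formula (4.6)**: for a prime `p > 3` and the curve `E : y² = x³ + ax + b` over `𝔽_p`,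
after applying the Gross–Koblitz formula,
`a_p(E) = (-φ(b)p/(p-1))·[1 - Σ_{j=1}^{p-2} (-p)^{E_j}
  (Γ_p(⟨-j/(p-1)⟩)Γ_p(⟨3j/(p-1)⟩)Γ_p(⟨-4j/(p-1)⟩)/Γ_p(⟨-2j/(p-1)⟩))·ω̄^j(16b²/a³)]`,
where `E_j = ⌊-2j/(p-1)⌋ - ⌊-j/(p-1)⌋ - ⌊3j/(p-1)⌋ - ⌊-4j/(p-1)⌋ - 1`.
Here `Γ` is Morita's `p`-adic gamma function and `ω` the Teichmüller character. -/
theorem trace_eq_padic_gamma_sum (p : ℕ) [Fact p.Prime] (hp3 : 3 < p)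
    (Γ : ℤ_[p] → ℤ_[p]) (hΓcont : Continuous Γ) (hΓzero : Γ 0 = 1)
    (hΓnat : ∀ m : ℕ, 0 < m →
      Γ (m : ℤ_[p]) = (-1) ^ m * ∏ k ∈ (Finset.Ico 1 m).filter (fun k => ¬ p ∣ k), (k : ℤ_[p]))
    (ω : ZMod p → ℤ_[p]) (hω0 : ω 0 = 0)
    (hωmul : ∀ x y : ZMod p, ω (x * y) = ω x * ω y)
    (hωunit : ∀ x : ZMod p, x ≠ 0 → IsUnit (ω x))
    (hωcong : ∀ x : ZMod p, (p : ℤ_[p]) ∣ (ω x - (x.val : ℤ_[p])))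
    (a b : ZMod p) (ha : a ≠ 0) (hb : b ≠ 0) (hns : 4 * a ^ 3 + 27 * b ^ 2 ≠ 0) :
    ((p : ℚ_[p]) -
        ((Finset.univ.filter
          (fun xy : ZMod p × ZMod p => xy.2 ^ 2 = xy.1 ^ 3 + a * xy.1 + b)).card : ℚ_[p])) =
      (-(quadraticChar (ZMod p) b : ℚ_[p]) * (p : ℚ_[p]) / ((p : ℚ_[p]) - 1)) *
        (1 - ∑ j ∈ Finset.Ico 1 (p - 1),
          (-(p : ℚ_[p])) ^
              (Int.floor (-2 * (j : ℚ) / ((p : ℚ) - 1)) -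
                Int.floor (-(j : ℚ) / ((p : ℚ) - 1)) -
                Int.floor (3 * (j : ℚ) / ((p : ℚ) - 1)) -
                Int.floor (-4 * (j : ℚ) / ((p : ℚ) - 1)) - 1) *
            ((Γ (toZp p (Int.fract (-(j : ℚ) / ((p : ℚ) - 1)))) : ℚ_[p]) *
                (Γ (toZp p (Int.fract (3 * (j : ℚ) / ((p : ℚ) - 1)))) : ℚ_[p]) *
                (Γ (toZp p (Int.fract (-4 * (j : ℚ) / ((p : ℚ) - 1)))) : ℚ_[p]) /
                (Γ (toZp p (Int.fract (-2 * (j : ℚ) / ((p : ℚ) - 1)))) : ℚ_[p])) *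
            (((ω (16 * b ^ 2 / a ^ 3) : ℚ_[p]))⁻¹) ^ j) := by
  let K := PadicComplex p
  have hp := (Fact.out : p.Prime)
  have hΓ : IsMoritaGamma p Γ := ⟨hΓcont, hΓzero, hΓnat⟩
  obtain ⟨ϖ, hϖ⟩ := IsAlgClosed.exists_pow_nat_eq (-(p : K)) (n := p - 1) (by lia)
  obtain ⟨χ₀, hχ₀⟩ := exists_mulChar_eq_teichmuller hω0 hωmul hωunit
  let χ : MulChar (ZMod p) K := χ₀.ringHomComp (algebraMap ℚ_[p] K)
  have hχω : ∀ x, χ x = algebraMap ℚ_[p] K (ω x) := fun x =>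
    congrArg (algebraMap ℚ_[p] K) (hχ₀ x)
  have hχ : ∀ x y, ‖χ (x + y) - χ x - χ y‖ < 1 := fun x y => by
    rw [hχω, hχω, hχω, ← map_sub, ← map_sub, norm_algebraMap', ← PadicInt.coe_sub,
      ← PadicInt.coe_sub, ← PadicInt.norm_def]
    exact norm_teichmuller_add_sub_lt hωcong x y
  have h := elliptic_trace_formula hΓ (by lia) hϖ hχ ha hb
  apply (algebraMap ℚ_[p] K).injective
  push_cast at h
  simp only [map_sub, map_mul, map_div₀, map_sum, map_zpow₀, map_pow, map_inv₀, map_natCast,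
    map_intCast, map_neg, map_one]
  simp only [hχω] at h
  rw [quadraticMulChar_apply] at h
  convert h
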